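/- arXiv:1509.05439 — 3 statements merged into one kernel-verified Lean document; each statement's English description precedes it below -/
import Mathlib

section
/- Let 1 ≤ k ≤ d be integers, let M ⊆ ℝ^d be a C^∞ submanifold of dimension k, and let λ_M denote the smooth volume measure on M (equivalently, the k-dimensional Hausdorff measure restricted to M). If λ_M-almost every point of M is nondegenerate, then λ_M(VWA_M(ψ_{c(k,d)})) = 0. -/
open Set Filter Metric MeasureTheory
noncomputable section

/-- A point of `ℝ^d` is *rational* if all of its coordinates are rational numbers. -/
def IsRatPt {d : ℕ} (x : Fin d → ℝ) : Prop := ∀ i, ∃ a : ℚ, x i = (a : ℝ)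

/-- The *height* of a rational point `x ∈ ℚ^d ⊆ ℝ^d`: the least positive integer `q`
with `q • x ∈ ℤ^d`. -/
def ht {d : ℕ} (x : Fin d → ℝ) : ℕ :=
  sInf {q : ℕ | 0 < q ∧ ∀ i, ∃ m : ℤ, (q : ℝ) * x i = (m : ℝ)}

/-- `Ssum k n = [k-1,1] + [k-1,2] + ⋯ + [k-1,n]` where `[n,m] = C(n+m,m)`. -/
def Ssum (k n : ℕ) : ℕ := ∑ j ∈ Finset.Icc 1 n, Nat.choose (k - 1 + j) j

/-- `nkd k d` is the largest `n ≥ 0` with `[k-1,1] + ⋯ + [k-1,n] ≤ d`. -/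
def nkd (k d : ℕ) : ℕ := sSup {n : ℕ | Ssum k n ≤ d}

/-- `mkd k d = d − ([k-1,1] + ⋯ + [k-1,n_{k,d}])`. -/
def mkd (k d : ℕ) : ℕ := d - Ssum k (nkd k d)

/-- `Nkd k d = 1·[k-1,1] + 2·[k-1,2] + ⋯ + n_{k,d}·[k-1,n_{k,d}] + (n_{k,d}+1)·m_{k,d}`. -/
def Nkd (k d : ℕ) : ℕ :=
  (∑ j ∈ Finset.Icc 1 (nkd k d), j * Nat.choose (k - 1 + j) j) + (nkd k d + 1) * mkd k d

/-- The exponent `c(k,d) = (d+1)/N_{k,d}`. -/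
def ckd (k d : ℕ) : ℝ := (d + 1) / (Nkd k d)

/-- Directional derivative operator: `dirD v f x = Df(x)(v)`. -/
def dirD {E F : Type*} [NormedAddCommGroup E] [NormedSpace ℝ E]
    [NormedAddCommGroup F] [NormedSpace ℝ F] (v : E) (f : E → F) : E → F :=
  fun x => fderiv ℝ f x v

/-- Iterated partial derivative `∂^α` with respect to the directions `e i`,
where direction `e i` is applied `α i` times. -/
def multiD {ι : Type*} [Fintype ι] {E F : Type*} [NormedAddCommGroup E] [NormedSpace ℝ E]
    [NormedAddCommGroup F] [NormedSpace ℝ F] (e : ι → E) (α : ι → ℕ) (f : E → F) : E → F :=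
  (Finset.univ : Finset ι).toList.foldr (fun i g => (dirD (e i))^[α i] g) f

/-- The partial derivative `∂^α f` for a multi-index `α ∈ ℕ^k`. -/
def mderiv {k : ℕ} {F : Type*} [NormedAddCommGroup F] [NormedSpace ℝ F]
    (α : Fin k → ℕ) (f : (Fin k → ℝ) → F) : (Fin k → ℝ) → F :=
  multiD (fun i => Pi.single i (1 : ℝ)) α f

/-- `Φ : U → M` is a `C^∞` local parameterization of the `k`-dimensional submanifold
`M ⊆ ℝ^d`: `U` is open, `Φ` is smooth and injective on `U` with everywhere injective
differential, and `Φ` is a homeomorphism of `U` onto a relatively open subset of `M`. -/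
structure IsLocParam (k d : ℕ) (M : Set (Fin d → ℝ)) (U : Set (Fin k → ℝ))
    (Φ : (Fin k → ℝ) → (Fin d → ℝ)) : Prop where
  open_dom : IsOpen U
  smooth : ContDiffOn ℝ (⊤ : ℕ∞) Φ U
  inj : Set.InjOn Φ U
  maps_to : Φ '' U ⊆ M
  immersion : ∀ v ∈ U, Function.Injective (fderiv ℝ Φ v)
  open_map : ∀ s : Set (Fin k → ℝ), IsOpen s →
    ∃ O : Set (Fin d → ℝ), IsOpen O ∧ Φ '' (s ∩ U) = O ∩ M

/-- `M ⊆ ℝ^d` is a `C^∞` submanifold of dimension `k`. -/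
def IsSmoothSubmanifold (k d : ℕ) (M : Set (Fin d → ℝ)) : Prop :=
  ∀ x ∈ M, ∃ (U : Set (Fin k → ℝ)) (Φ : (Fin k → ℝ) → (Fin d → ℝ)),
    IsLocParam k d M U Φ ∧ x ∈ Φ '' U

/-- `x ∈ M` is `D`-nondegenerate: for some local parameterization `Φ` with `Φ v = x`,
the partial derivatives `∂^α Φ(v)`, `0 < |α| ≤ D`, span `ℝ^d`. -/
def IsNondegAt (k d D : ℕ) (M : Set (Fin d → ℝ)) (x : Fin d → ℝ) : Prop :=
  ∃ (U : Set (Fin k → ℝ)) (Φ : (Fin k → ℝ) → (Fin d → ℝ)) (v : Fin k → ℝ),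
    IsLocParam k d M U Φ ∧ v ∈ U ∧ Φ v = x ∧
    Submodule.span ℝ {y : Fin d → ℝ | ∃ α : Fin k → ℕ,
      0 < (∑ j, α j) ∧ (∑ j, α j) ≤ D ∧ y = mderiv α Φ v} = ⊤

/-- `x ∈ M` is nondegenerate if it is `D`-nondegenerate for some `D`. -/
def IsNondeg (k d : ℕ) (M : Set (Fin d → ℝ)) (x : Fin d → ℝ) : Prop :=
  ∃ D : ℕ, IsNondegAt k d D M x

/-- The set `BA_M(ψ_c)` of `ψ_c`-badly intrinsically approximable points of `M`. -/
def BAset {d : ℕ} (M : Set (Fin d → ℝ)) (c : ℝ) : Set (Fin d → ℝ) :=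
  {x ∈ M | ∃ κ > (0 : ℝ), ∀ r : Fin d → ℝ, IsRatPt r → r ∈ M →
    κ * (ht r : ℝ) ^ (-c) ≤ ‖x - r‖}

/-- The set `VWA_M(ψ_c)` of `ψ_c`-very well intrinsically approximable points of `M`. -/
def VWAset {d : ℕ} (M : Set (Fin d → ℝ)) (c : ℝ) : Set (Fin d → ℝ) :=
  {x ∈ M | ∃ ε > (0 : ℝ),
    {r : Fin d → ℝ | IsRatPt r ∧ r ∈ M ∧ ‖x - r‖ ≤ (ht r : ℝ) ^ (-(c + ε))}.Infinite}

/-- `ψ` is a Dirichlet function for intrinsic approximation on `S ⊆ ℝ^m`. -/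
def IsDirichletFn {m : ℕ} (S : Set (Fin m → ℝ)) (ψ : ℝ → ℝ) : Prop :=
  (∀ t : ℝ, 0 < t → 0 < ψ t) ∧
  ∀ x ∈ S, ∃ C > (0 : ℝ), ∃ r : ℕ → (Fin m → ℝ),
    (∀ n, IsRatPt (r n) ∧ r n ∈ S) ∧ Filter.Tendsto r Filter.atTop (nhds x) ∧
    ∀ n, ‖x - r n‖ ≤ C * ψ (ht (r n))

/-- The closed `t`-neighborhood `S^{(t)}` of a set `S`. -/
def cnbhd {E : Type*} [PseudoMetricSpace E] (S : Set E) (t : ℝ) : Set E :=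
  {x | ∃ y ∈ S, dist x y ≤ t}

/-- `x` belongs to the (topological) support of the measure `μ`. -/
def InSupp {k : ℕ} (μ : Measure (Fin k → ℝ)) (x : Fin k → ℝ) : Prop :=
  ∀ ρ > (0 : ℝ), 0 < μ (ball x ρ)

/-- `μ` is absolutely decaying on `U`. -/
def AbsolutelyDecaying {k : ℕ} (μ : Measure (Fin k → ℝ)) (U : Set (Fin k → ℝ)) : Prop :=
  ∃ C > (0 : ℝ), ∃ a > (0 : ℝ), ∀ x, InSupp μ x → ∀ ρ : ℝ, 0 < ρ → ρ ≤ 1 →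
    closedBall x ρ ⊆ U → ∀ ε > (0 : ℝ), ∀ (w : Fin k → ℝ) (b : ℝ), w ≠ 0 →
      μ (cnbhd {y : Fin k → ℝ | ∑ j, w j * y j = b} (ε * ρ) ∩ closedBall x ρ) ≤
        ENNReal.ofReal (C * ε ^ a) * μ (closedBall x ρ)

/-- `μ` is doubling. -/
def IsDoubling {k : ℕ} (μ : Measure (Fin k → ℝ)) : Prop :=
  ∃ C > (0 : ℝ), ∀ x, InSupp μ x → ∀ ρ : ℝ, 0 < ρ → ρ ≤ 1 →
    μ (closedBall x (2 * ρ)) ≤ ENNReal.ofReal C * μ (closedBall x ρ)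

/-- `μ` is absolutely friendly on `U`: absolutely decaying and doubling. -/
def AbsolutelyFriendly {k : ℕ} (μ : Measure (Fin k → ℝ)) (U : Set (Fin k → ℝ)) : Prop :=
  AbsolutelyDecaying μ U ∧ IsDoubling μ

/-- The class `P_D` of polynomials of degree at most `D` whose coefficient of largest
absolute value has absolute value exactly `1`. -/
def IsPD (k D : ℕ) (p : MvPolynomial (Fin k) ℝ) : Prop :=
  p.totalDegree ≤ D ∧ (∀ m, |p.coeff m| ≤ 1) ∧ ∃ m, |p.coeff m| = 1

/-- Partial derivative within a set `s`, in the `i`-th coordinate direction. -/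
def pderivW {k : ℕ} (s : Set (Fin k → ℝ)) (i : Fin k) (f : (Fin k → ℝ) → ℝ) :
    (Fin k → ℝ) → ℝ :=
  fun x => fderivWithin ℝ f s x (Pi.single i 1)

/-- Iterated partial derivative `∂^α f` within a set `s`. -/
def mderivW {k : ℕ} (s : Set (Fin k → ℝ)) (α : Fin k → ℕ) (f : (Fin k → ℝ) → ℝ) :
    (Fin k → ℝ) → ℝ :=
  (List.finRange k).foldr (fun i g => (pderivW s i)^[α i] g) f

/-- The `C^D` norm `‖f‖_{C^D,B}` of `f` on `B`. -/
def CDnorm {k : ℕ} (D : ℕ) (B : Set (Fin k → ℝ)) (f : (Fin k → ℝ) → ℝ) : ℝ :=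
  sSup {y : ℝ | ∃ α : Fin k → ℕ, (∑ j, α j) ≤ D ∧ ∃ x ∈ B, y = |mderivW B α f x|}

/-- Analytic local parameterization. -/
structure IsAnalLocParam (k d : ℕ) (M : Set (Fin d → ℝ)) (U : Set (Fin k → ℝ))
    (Φ : (Fin k → ℝ) → (Fin d → ℝ)) : Prop where
  open_dom : IsOpen U
  analytic : AnalyticOnNhd ℝ Φ U
  inj : Set.InjOn Φ U
  maps_to : Φ '' U ⊆ M
  immersion : ∀ v ∈ U, Function.Injective (fderiv ℝ Φ v)
  open_map : ∀ s : Set (Fin k → ℝ), IsOpen s →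
    ∃ O : Set (Fin d → ℝ), IsOpen O ∧ Φ '' (s ∩ U) = O ∩ M

/-- `M ⊆ ℝ^d` is a real-analytic submanifold of dimension `k`. -/
def IsAnalSubmanifold (k d : ℕ) (M : Set (Fin d → ℝ)) : Prop :=
  ∀ x ∈ M, ∃ (U : Set (Fin k → ℝ)) (Φ : (Fin k → ℝ) → (Fin d → ℝ)),
    IsAnalLocParam k d M U Φ ∧ x ∈ Φ '' U

/-- `D`-nondegeneracy via an analytic local parameterization. -/
def IsAnalNondegAt (k d D : ℕ) (M : Set (Fin d → ℝ)) (x : Fin d → ℝ) : Prop :=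
  ∃ (U : Set (Fin k → ℝ)) (Φ : (Fin k → ℝ) → (Fin d → ℝ)) (v : Fin k → ℝ),
    IsAnalLocParam k d M U Φ ∧ v ∈ U ∧ Φ v = x ∧
    Submodule.span ℝ {y : Fin d → ℝ | ∃ α : Fin k → ℕ,
      0 < (∑ j, α j) ∧ (∑ j, α j) ≤ D ∧ y = mderiv α Φ v} = ⊤

/-- Nondegeneracy via an analytic local parameterization. -/
def IsAnalNondeg (k d : ℕ) (M : Set (Fin d → ℝ)) (x : Fin d → ℝ) : Prop :=
  ∃ D : ℕ, IsAnalNondegAt k d D M x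

section MultiIndex

variable {k : ℕ} {E : Type*} [NormedAddCommGroup E] [NormedSpace ℝ E]

theorem contDiff_dirD {F : (Fin k → ℝ) → E} (hF : ContDiff ℝ (⊤ : ℕ∞) F) (v : Fin k → ℝ) :
    ContDiff ℝ (⊤ : ℕ∞) (dirD v F) :=
  (hF.fderiv_right (by norm_cast)).clm_apply contDiff_const

theorem contDiff_dirD_iterate {F : (Fin k → ℝ) → E} (hF : ContDiff ℝ (⊤ : ℕ∞) F)
    (v : Fin k → ℝ) (n : ℕ) : ContDiff ℝ (⊤ : ℕ∞) ((dirD v)^[n] F) := by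
  induction n generalizing F with
  | zero => exact hF
  | succ n ih => exact ih (contDiff_dirD hF v)

theorem dirD_comm {F : (Fin k → ℝ) → E} (hF : ContDiff ℝ (⊤ : ℕ∞) F) (v w : Fin k → ℝ) :
    dirD v (dirD w F) = dirD w (dirD v F) := by
  have key : ∀ v w x, dirD v (dirD w F) x = fderiv ℝ (fderiv ℝ F) x v w := by
    intro v w x
    have h1 : DifferentiableAt ℝ (fderiv ℝ F) x :=
      ((hF.fderiv_right (m := (⊤ : ℕ∞)) (by norm_cast)).differentiable (by simp)) x
    change fderiv ℝ (fun y => fderiv ℝ F y w) x v = _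
    rw [fderiv_clm_apply h1 (differentiableAt_const _)]
    simp
  ext x
  rw [key, key]
  have := (hF.contDiffAt (x := x)).isSymmSndFDerivAt (by simp; norm_cast)
  exact this v w

theorem dirD_comm_iterate {F : (Fin k → ℝ) → E} (hF : ContDiff ℝ (⊤ : ℕ∞) F)
    (v w : Fin k → ℝ) (n : ℕ) : dirD v ((dirD w)^[n] F) = (dirD w)^[n] (dirD v F) := by
  induction n generalizing F with
  | zero => rfl
  | succ n ih =>
    rw [Function.iterate_succ_apply, ih (contDiff_dirD hF w), dirD_comm hF,
      Function.iterate_succ_apply]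

theorem contDiff_foldr_dirD {F : (Fin k → ℝ) → E} (hF : ContDiff ℝ (⊤ : ℕ∞) F)
    (e : Fin k → Fin k → ℝ) (α : Fin k → ℕ) (l : List (Fin k)) :
    ContDiff ℝ (⊤ : ℕ∞) (l.foldr (fun i g => (dirD (e i))^[α i] g) F) := by
  induction l with
  | nil => exact hF
  | cons a l ih => exact contDiff_dirD_iterate ih _ _

theorem dirD_foldr_dirD {F : (Fin k → ℝ) → E} (hF : ContDiff ℝ (⊤ : ℕ∞) F)
    (e : Fin k → Fin k → ℝ) (α : Fin k → ℕ) (a : Fin k) (l : List (Fin k)) (hl : l.Nodup)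
    (ha : a ∈ l) :
    dirD (e a) (l.foldr (fun i g => (dirD (e i))^[α i] g) F) =
      l.foldr (fun i g => (dirD (e i))^[(α + Pi.single a 1 : Fin k → ℕ) i] g) F := by
  induction l with
  | nil => simp at ha
  | cons b l ih =>
    rw [List.nodup_cons] at hl
    simp only [List.foldr_cons]
    by_cases hab : a = b
    · subst hab
      have : l.foldr (fun i g => (dirD (e i))^[(α + Pi.single a 1 : Fin k → ℕ) i] g) F =
          l.foldr (fun i g => (dirD (e i))^[α i] g) F := by
        refine List.foldr_ext _ _ _ fun i hi g => ?_
        have : i ≠ a := fun h => hl.1 (h ▸ hi)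
        simp [this]
      rw [this]
      simp [Function.iterate_succ_apply']
    · rw [dirD_comm_iterate (contDiff_foldr_dirD hF e α l),
        ih hl.2 ((List.mem_cons.1 ha).resolve_left hab)]
      simp [Ne.symm hab]

theorem mderiv_zero (F : (Fin k → ℝ) → E) : mderiv 0 F = F := by
  unfold mderiv multiD
  induction (Finset.univ : Finset (Fin k)).toList with
  | nil => rfl
  | cons a l ih => simp

theorem contDiff_mderiv {F : (Fin k → ℝ) → E} (hF : ContDiff ℝ (⊤ : ℕ∞) F) (α : Fin k → ℕ) :
    ContDiff ℝ (⊤ : ℕ∞) (mderiv α F) := contDiff_foldr_dirD hF _ _ _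

theorem dirD_mderiv {F : (Fin k → ℝ) → E} (hF : ContDiff ℝ (⊤ : ℕ∞) F) (α : Fin k → ℕ)
    (a : Fin k) : dirD (Pi.single a 1) (mderiv α F) = mderiv (α + Pi.single a 1) F :=
  dirD_foldr_dirD hF (fun i => Pi.single i 1) α a _ (Finset.nodup_toList _)
    (Finset.mem_toList.2 (Finset.mem_univ a))

theorem fderiv_mderiv {F : (Fin k → ℝ) → E} (hF : ContDiff ℝ (⊤ : ℕ∞) F) (α : Fin k → ℕ)
    (x h : Fin k → ℝ) :
    fderiv ℝ (mderiv α F) x h = ∑ a, h a • mderiv (α + Pi.single a 1) F x := by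
  have : h = ∑ a, h a • (Pi.single a 1 : Fin k → ℝ) := by
    simpa using (pi_eq_sum_univ' h)
  conv_lhs => rw [this]
  rw [map_sum]
  refine Finset.sum_congr rfl fun a _ => ?_
  rw [map_smul, ← dirD_mderiv hF]; rfl

theorem iterate_dirD_congr {F G : (Fin k → ℝ) → E} {s : Set (Fin k → ℝ)} (hs : IsOpen s)
    (h : EqOn F G s) (v : Fin k → ℝ) (n : ℕ) : EqOn ((dirD v)^[n] F) ((dirD v)^[n] G) s := by
  induction n generalizing F G with
  | zero => exact h
  | succ n ih =>
    refine ih fun x hx => ?_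
    simp only [dirD]
    rw [(h.eventuallyEq_of_mem (hs.mem_nhds hx)).fderiv_eq]

theorem mderiv_congr {F G : (Fin k → ℝ) → E} {s : Set (Fin k → ℝ)} (hs : IsOpen s)
    (h : EqOn F G s) (α : Fin k → ℕ) : EqOn (mderiv α F) (mderiv α G) s := by
  unfold mderiv multiD
  induction (Finset.univ : Finset (Fin k)).toList with
  | nil => exact h
  | cons a l ih => exact iterate_dirD_congr hs ih _ _

/-- The multi-index counting how often each coordinate occurs in the tuple `i`. -/
def tupleIndex {j : ℕ} (i : Fin j → Fin k) : Fin k → ℕ := ∑ l, Pi.single (i l) 1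

theorem sum_tupleIndex {j : ℕ} (i : Fin j → Fin k) : ∑ a, tupleIndex i a = j := by
  unfold tupleIndex
  simp only [Finset.sum_apply]
  rw [Finset.sum_comm]
  simp [Finset.sum_pi_single']

theorem tupleIndex_cons {j : ℕ} (a : Fin k) (i : Fin j → Fin k) :
    tupleIndex (Fin.cons a i : Fin (j + 1) → Fin k) = tupleIndex i + Pi.single a 1 := by
  simp [tupleIndex, Fin.sum_univ_succ, add_comm]

theorem exists_tupleIndex_eq (α : Fin k → ℕ) (j : ℕ) (hα : ∑ a, α a = j) :
    ∃ i : Fin j → Fin k, tupleIndex i = α := by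
  induction j generalizing α with
  | zero =>
    refine ⟨Fin.elim0, ?_⟩
    ext a
    have := (Finset.sum_eq_zero_iff.1 hα) a (Finset.mem_univ a)
    simp [tupleIndex, this]
  | succ j ih =>
    obtain ⟨a, ha⟩ : ∃ a, α a ≠ 0 := by
      by_contra! h
      simp [h] at hα
    have hle : Pi.single a 1 ≤ α := by
      intro b
      by_cases hb : b = a
      · subst hb; simp; omega
      · simp [hb]
    have hsub : α - Pi.single a 1 + Pi.single a 1 = α := tsub_add_cancel_of_le hle
    obtain ⟨i, hi⟩ := ih (α - Pi.single a 1) (by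
      have h2 : ∑ b, ((α - Pi.single a 1 : Fin k → ℕ) b + (Pi.single a 1 : Fin k → ℕ) b) = j + 1 := by
        rw [← hα]; exact Finset.sum_congr rfl fun b _ => congrFun hsub b
      rw [Finset.sum_add_distrib] at h2
      simpa [Finset.sum_pi_single'] using h2)
    exact ⟨Fin.cons a i, by rw [tupleIndex_cons, hi, hsub]⟩

theorem prod_tuple_eq_prod_pow {j : ℕ} (i : Fin j → Fin k) (h : Fin k → ℝ) :
    ∏ l, h (i l) = ∏ a, h a ^ tupleIndex i a := by
  unfold tupleIndex
  simp only [Finset.sum_apply, ← Finset.prod_pow_eq_pow_sum]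
  rw [Finset.prod_comm]
  refine Finset.prod_congr rfl fun l _ => ?_
  rw [Finset.prod_eq_single (i l)] <;> simp +contextual

theorem iteratedDeriv_line {F : (Fin k → ℝ) → E} (hF : ContDiff ℝ (⊤ : ℕ∞) F)
    (x h : Fin k → ℝ) (j : ℕ) :
    iteratedDeriv j (fun t : ℝ => F (x + t • h)) =
      fun t => ∑ i : Fin j → Fin k, (∏ l, h (i l)) • mderiv (tupleIndex i) F (x + t • h) := by
  induction j with
  | zero =>
    ext t
    simp [tupleIndex, mderiv_zero]
  | succ j ih =>
    ext t
    rw [iteratedDeriv_succ, ih]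
    have hl : HasDerivAt (fun t : ℝ => x + t • h) h t := by
      simpa using ((hasDerivAt_id t).smul_const h).const_add x
    have hd : ∀ i : Fin j → Fin k,
        HasDerivAt (fun t : ℝ => (∏ l, h (i l)) • mderiv (tupleIndex i) F (x + t • h))
          ((∏ l, h (i l)) • fderiv ℝ (mderiv (tupleIndex i) F) (x + t • h) h) t := fun i =>
      ((((contDiff_mderiv hF _).differentiable (by simp)) _).hasFDerivAt.comp_hasDerivAt t
        hl).const_smul _
    rw [(HasDerivAt.fun_sum fun i _ => hd i).deriv]
    rw [← (Fin.consEquiv fun _ => Fin k).sum_comp, Fintype.sum_prod_type_right]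
    refine Finset.sum_congr rfl fun i _ => ?_
    rw [fderiv_mderiv hF, Finset.smul_sum]
    refine Finset.sum_congr rfl fun a _ => ?_
    simp [Fin.consEquiv, Fin.prod_univ_succ, tupleIndex_cons, smul_smul, mul_comm]

end MultiIndex

section Taylor

variable {k : ℕ} {E : Type*} [NormedAddCommGroup E] [NormedSpace ℝ E]

/-- The multi-indices of order at most `n`. -/
def multiIdx (k n : ℕ) : Finset (Fin k → ℕ) :=
  (Finset.range (n + 1)).biUnion fun j => Finset.univ.piAntidiag j

theorem mem_multiIdx {n : ℕ} {α : Fin k → ℕ} : α ∈ multiIdx k n ↔ ∑ a, α a ≤ n := by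
  simp [multiIdx, Finset.mem_piAntidiag]

/-- The coefficient of `h ^ α • ∂^α F` in Taylor's formula. -/
def taylorWeight (α : Fin k → ℕ) : ℝ :=
  ((∑ a, α a).factorial : ℝ)⁻¹ *
    (Finset.univ.filter fun i : Fin (∑ a, α a) → Fin k => tupleIndex i = α).card

theorem taylorWeight_ne_zero (α : Fin k → ℕ) : taylorWeight α ≠ 0 := by
  obtain ⟨i, hi⟩ := exists_tupleIndex_eq α _ rfl
  have : (Finset.univ.filter fun i : Fin (∑ a, α a) → Fin k => tupleIndex i = α).Nonempty :=
    ⟨i, by simp [hi]⟩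
  unfold taylorWeight
  have := this.card_pos
  positivity

theorem sum_tuples_eq_sum_multiIdx (n : ℕ) (c : (Fin k → ℕ) → E) :
    ∑ j ∈ Finset.range (n + 1), ((j.factorial : ℝ)⁻¹ • ∑ i : Fin j → Fin k, c (tupleIndex i)) =
      ∑ α ∈ multiIdx k n, taylorWeight α • c α := by
  unfold multiIdx
  rw [Finset.sum_biUnion]
  · refine Finset.sum_congr rfl fun j _ => ?_
    rw [← Finset.sum_fiberwise_of_maps_to (s := Finset.univ) (t := Finset.univ.piAntidiag j)
      (g := fun i : Fin j → Fin k => tupleIndex i)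
      (fun i _ => by simp [Finset.mem_piAntidiag, sum_tupleIndex]), Finset.smul_sum]
    refine Finset.sum_congr rfl fun α hα => ?_
    have hj : ∑ a, α a = j := by simpa [Finset.mem_piAntidiag] using hα
    subst hj
    rw [Finset.sum_congr rfl (g := fun _ => c α) (by simp +contextual)]
    simp [taylorWeight, ← Nat.cast_smul_eq_nsmul ℝ, smul_smul]
  · intro j _ j' _ hjj
    rw [Function.onFun, Finset.disjoint_left]
    intro α h1 h2
    simp [Finset.mem_piAntidiag] at h1 h2
    exact hjj (h1.symm.trans h2)

theorem exists_taylor_bound {F : (Fin k → ℝ) → E} (hF : ContDiff ℝ (⊤ : ℕ∞) F)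
    (v : Fin k → ℝ) (R : ℝ) (n : ℕ) :
    ∃ C : ℝ, 0 < C ∧ ∀ x ∈ closedBall v R, ∀ h, x + h ∈ closedBall v R →
      ‖F (x + h) - ∑ α ∈ multiIdx k n, (taylorWeight α * ∏ a, h a ^ α a) • mderiv α F x‖ ≤
        C * ‖h‖ ^ (n + 1) := by
  have hb : ∀ i : Fin (n + 1) → Fin k, ∃ K : ℝ, 0 ≤ K ∧ ∀ y ∈ closedBall v R,
      ‖mderiv (tupleIndex i) F y‖ ≤ K := by
    intro i
    obtain ⟨K, hK⟩ := (isCompact_closedBall v R).exists_bound_of_continuousOn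
      (contDiff_mderiv hF (tupleIndex i)).continuous.continuousOn
    exact ⟨max K 0, le_max_right _ _, fun y hy => (hK y hy).trans (le_max_left _ _)⟩
  choose K hK0 hK using hb
  refine ⟨∑ i, K i + 1, add_pos_of_nonneg_of_pos (Finset.sum_nonneg fun i _ => hK0 i) one_pos,
    fun x hx h hxh => ?_⟩
  have hg : ContDiff ℝ (⊤ : ℕ∞) (fun t : ℝ => F (x + t • h)) :=
    hF.comp (contDiff_const.add (contDiff_id.smul contDiff_const))
  have hW : ∀ j, ∀ t ∈ Icc (0 : ℝ) 1,
      iteratedDerivWithin j (fun t : ℝ => F (x + t • h)) (Icc 0 1) t =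
        ∑ i : Fin j → Fin k, (∏ l, h (i l)) • mderiv (tupleIndex i) F (x + t • h) := by
    intro j t ht
    rw [iteratedDerivWithin_eq_iteratedDeriv (uniqueDiffOn_Icc one_pos)
      (hg.of_le (by norm_cast; exact le_top)).contDiffAt ht, iteratedDeriv_line hF]
  have hC : ∀ t ∈ Icc (0 : ℝ) 1,
      ‖iteratedDerivWithin (n + 1) (fun t : ℝ => F (x + t • h)) (Icc 0 1) t‖ ≤
        (∑ i, K i) * ‖h‖ ^ (n + 1) := by
    intro t ht
    have hmem : x + t • h ∈ closedBall v R := by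
      have := (convex_closedBall v R).add_smul_mem hx hxh ht
      exact this
    rw [hW _ _ ht, Finset.sum_mul]
    refine (norm_sum_le _ _).trans (Finset.sum_le_sum fun i _ => ?_)
    rw [norm_smul, mul_comm]
    refine mul_le_mul (hK i _ hmem) ?_ (norm_nonneg _) (hK0 i)
    rw [norm_prod]
    refine (Finset.prod_le_prod (fun l _ => norm_nonneg _)
      fun l _ => norm_le_pi_norm h (i l)).trans ?_
    simp
  have key := taylor_mean_remainder_bound (n := n) zero_le_one
    (hg.of_le (by norm_cast; exact le_top)).contDiffOn (right_mem_Icc.2 zero_le_one) hC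
  rw [taylor_within_apply] at key
  have e1 : ∑ j ∈ Finset.range (n + 1), (((j.factorial : ℝ)⁻¹ * (1 - 0) ^ j) •
      iteratedDerivWithin j (fun t : ℝ => F (x + t • h)) (Icc 0 1) 0) =
      ∑ α ∈ multiIdx k n, (taylorWeight α * ∏ a, h a ^ α a) • mderiv α F x := by
    simp only [mul_smul]
    rw [← sum_tuples_eq_sum_multiIdx n fun α => (∏ a, h a ^ α a) • mderiv α F x]
    refine Finset.sum_congr rfl fun j _ => ?_
    rw [hW j 0 (left_mem_Icc.2 zero_le_one)]
    simp [prod_tuple_eq_prod_pow]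
  rw [e1] at key
  simp only [one_smul, sub_zero, one_pow, mul_one] at key
  refine key.trans ?_
  refine (div_le_self ?_ (by exact_mod_cast Nat.succ_le_of_lt n.factorial_pos)).trans ?_
  · exact mul_nonneg (Finset.sum_nonneg fun i _ => hK0 i) (by positivity)
  · gcongr; linarith

end Taylor

section Determinant

theorem Ssum_mono (k : ℕ) : Monotone (Ssum k) := fun _ _ h =>
  Finset.sum_le_sum_of_subset (Finset.Icc_subset_Icc_right h)

theorem Ssum_succ (k n : ℕ) : Ssum k (n + 1) = Ssum k n + (k - 1 + (n + 1)).choose (n + 1) :=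
  Finset.sum_Icc_succ_top (by omega) _

theorem card_multiIdx_le {k : ℕ} (hk : 1 ≤ k) (n : ℕ) : (multiIdx k n).card ≤ 1 + Ssum k n := by
  have hp : ∀ j, ((Finset.univ : Finset (Fin k)).piAntidiag j).card = (k - 1 + j).choose j := by
    intro j
    rw [← Finset.map_sym_eq_piAntidiag, Finset.card_map, Finset.sym_univ, Finset.card_univ,
      Sym.card_sym_eq_choose, Fintype.card_fin]
    congr 1
    omega
  refine Finset.card_biUnion_le.trans ?_
  simp only [hp]
  induction n with
  | zero => simp [Ssum]
  | succ n ih => rw [Finset.sum_range_succ, Ssum_succ]; omega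

theorem le_Ssum (k n : ℕ) : n ≤ Ssum k n := by
  induction n with
  | zero => simp
  | succ n ih =>
    have : 0 < (k - 1 + (n + 1)).choose (n + 1) := Nat.choose_pos (by omega)
    rw [Ssum_succ]; omega

theorem Ssum_nkd_le (k d : ℕ) : Ssum k (nkd k d) ≤ d :=
  Nat.sSup_mem (s := {n : ℕ | Ssum k n ≤ d}) ⟨0, by simp [Ssum]⟩
    ⟨d, fun n hn => (le_Ssum k n).trans hn⟩

theorem Nkd_eq_sum (k d : ℕ) : Nkd k d = ∑ j ∈ Finset.range (nkd k d + 1), (d - Ssum k j) := by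
  have key : ∀ n, Ssum k n ≤ d → (∑ j ∈ Finset.Icc 1 n, j * Nat.choose (k - 1 + j) j) +
      (n + 1) * (d - Ssum k n) = ∑ j ∈ Finset.range (n + 1), (d - Ssum k j) := by
    intro n
    induction n with
    | zero => simp
    | succ n ih =>
      intro h
      rw [Finset.sum_range_succ, ← ih ((Ssum_mono k n.le_succ).trans h),
        Finset.sum_Icc_succ_top (by omega)]
      have h1 := Ssum_succ k n
      obtain ⟨e, he⟩ := Nat.exists_eq_add_of_le h
      have h2 : d - Ssum k n = e + (k - 1 + (n + 1)).choose (n + 1) := by omega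
      have h3 : d - Ssum k (n + 1) = e := by omega
      rw [h2, h3]
      ring
  exact key _ (Ssum_nkd_le k d)

theorem Nkd_pos {k d : ℕ} (hd : 0 < d) : 0 < Nkd k d := by
  rw [Nkd_eq_sum, Finset.sum_range_succ']
  simp [Ssum, hd]

/-- The order in the radius of a term of the Taylor expansion; `none` is the remainder. -/
def termOrder {k n : ℕ} : Option (multiIdx k n) → ℕ
  | none => n + 1
  | some α => ∑ a, α.1 a

theorem termOrder_le {k n : ℕ} (o : Option (multiIdx k n)) : termOrder o ≤ n + 1 := by
  cases o with
  | none => exact le_rfl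
  | some α => exact (mem_multiIdx.1 α.2).trans n.le_succ

theorem Nkd_le_sum_termOrder {k d : ℕ} (hk : 1 ≤ k)
    (r : Fin (d + 1) → Option (multiIdx k (nkd k d)))
    (hr : ∀ i j α, r i = some α → r j = some α → i = j) :
    Nkd k d ≤ ∑ i, termOrder (r i) := by
  classical
  revert r
  set n := nkd k d with hn
  intro r hr
  have h1 : ∀ i, termOrder (r i) =
      ∑ j ∈ Finset.range (n + 1), if j < termOrder (r i) then 1 else 0 := by
    intro i
    rw [← Finset.card_filter]
    have : (Finset.range (n + 1)).filter (fun j => j < termOrder (r i)) =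
        Finset.range (termOrder (r i)) := by
      ext j
      have := termOrder_le (r i)
      simp only [Finset.mem_filter, Finset.mem_range]
      omega
    rw [this, Finset.card_range]
  rw [Finset.sum_congr rfl fun i _ => h1 i, Finset.sum_comm, Nkd_eq_sum]
  refine Finset.sum_le_sum fun j hj => ?_
  rw [← Finset.card_filter]
  have hjn : j ≤ n := Nat.lt_succ_iff.1 (Finset.mem_range.1 hj)
  have h2 : (Finset.univ.filter fun i => ¬ j < termOrder (r i)).card ≤ 1 + Ssum k j := by
    refine le_trans ?_ (card_multiIdx_le hk j)
    refine Finset.card_le_card_of_injOn (fun i => match r i with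
      | none => 0
      | some α => α.1) ?_ ?_
    · intro i hi
      have hi' : termOrder (r i) ≤ j := by simpa using hi
      simp only [Finset.mem_coe, mem_multiIdx]
      cases h : r i with
      | none => simp
      | some α => simpa [h, termOrder] using hi'
    · intro i hi i' hi' he
      have hi : termOrder (r i) ≤ j := by simpa using hi
      have hi' : termOrder (r i') ≤ j := by simpa using hi'
      cases h : r i with
      | none => simp [h, termOrder] at hi; omega
      | some α =>
        cases h' : r i' with
        | none => simp [h', termOrder] at hi'; omega
        | some α' =>
          simp only [h, h'] at he
          exact hr i i' α h (by rw [h', Subtype.ext he])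
  have h3 := Finset.card_filter_add_card_filter_not (s := (Finset.univ : Finset (Fin (d + 1))))
    (fun i => j < termOrder (r i))
  rw [Finset.card_univ, Fintype.card_fin] at h3
  omega

theorem abs_det_le_of_row_bounds {m : ℕ} (M : Matrix (Fin m) (Fin m) ℝ) (b : Fin m → ℝ)
    (hb : ∀ i j, |M i j| ≤ b i) : |M.det| ≤ m.factorial * ∏ i, b i := by
  rw [← Matrix.det_transpose, Matrix.det_apply']
  refine (Finset.abs_sum_le_sum_abs _ _).trans ?_
  refine (Finset.sum_le_sum (g := fun _ => ∏ i, b i) fun σ _ => ?_).trans ?_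
  · rw [abs_mul]
    have : |(((Equiv.Perm.sign σ : ℤˣ) : ℤ) : ℝ)| = 1 := by
      rcases Int.units_eq_one_or (Equiv.Perm.sign σ) with h | h <;> simp [h]
    rw [this, one_mul, Finset.abs_prod]
    exact Finset.prod_le_prod (fun _ _ => abs_nonneg _) fun i _ => hb _ _
  · simp [Fintype.card_perm]

theorem exists_det_bound {k d : ℕ} (hk : 1 ≤ k) {G : (Fin k → ℝ) → (Fin (d + 1) → ℝ)}
    (hG : ContDiff ℝ (⊤ : ℕ∞) G) (v : Fin k → ℝ) (R : ℝ) :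
    ∃ C : ℝ, 0 < C ∧ ∀ y ρ, 0 < ρ → ρ ≤ 1 → closedBall y ρ ⊆ closedBall v R →
      ∀ w : Fin (d + 1) → Fin k → ℝ, (∀ i, w i ∈ closedBall y ρ) →
        |(Matrix.of fun i => G (w i)).det| ≤ C * ρ ^ Nkd k d := by
  set n := nkd k d with hn
  obtain ⟨C₀, hC₀, hT⟩ := exists_taylor_bound hG v R n
  have hb : ∀ α : Fin k → ℕ, ∃ K : ℝ, 0 ≤ K ∧ ∀ y ∈ closedBall v R,
      ‖taylorWeight α • mderiv α G y‖ ≤ K := by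
    intro α
    obtain ⟨K, hK⟩ := (isCompact_closedBall v R).exists_bound_of_continuousOn
      ((contDiff_mderiv hG α).continuous.const_smul (taylorWeight α)).continuousOn
    exact ⟨max K 0, le_max_right _ _, fun y hy => (hK y hy).trans (le_max_left _ _)⟩
  choose K₀ hK₀ hK using hb
  set K := C₀ + ∑ α ∈ multiIdx k n, K₀ α with hKdef
  have hKpos : 0 < K := add_pos_of_pos_of_nonneg hC₀ (Finset.sum_nonneg fun α _ => hK₀ α)
  refine ⟨(Fintype.card (Fin (d + 1) → Option (multiIdx k n))) *
    ((d + 1).factorial * K ^ (d + 1)) + 1, by positivity, ?_⟩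
  intro y ρ hρ hρ1 hsub w hw
  have hy : y ∈ closedBall v R := hsub (mem_closedBall_self hρ.le)
  have hnorm : ∀ i, ‖w i - y‖ ≤ ρ := fun i => by simpa [dist_eq_norm] using hw i
  let g : Fin (d + 1) → Option (multiIdx k n) → Fin (d + 1) → ℝ := fun i o => match o with
    | none => G (w i) - ∑ α ∈ multiIdx k n,
        (taylorWeight α * ∏ a, (w i - y) a ^ α a) • mderiv α G y
    | some α => (taylorWeight α.1 * ∏ a, (w i - y) a ^ α.1 a) • mderiv α.1 G y
  have hsum : ∀ i, G (w i) = ∑ o, g i o := by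
    intro i
    rw [Fintype.sum_option]
    simp only [g]
    rw [Finset.sum_coe_sort (multiIdx k n)
      (fun α => (taylorWeight α * ∏ a, (w i - y) a ^ α a) • mderiv α G y)]
    simp
  have hg : ∀ i o, ‖g i o‖ ≤ K * ρ ^ termOrder o := by
    intro i o
    cases o with
    | none =>
      have := hT y hy (w i - y) (by simpa using hsub (hw i))
      rw [add_sub_cancel] at this
      refine this.trans ?_
      have : C₀ ≤ K := le_add_of_nonneg_right (Finset.sum_nonneg fun α _ => hK₀ α)
      simp only [termOrder]
      gcongr
      exact hnorm i
    | some α =>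
      simp only [g, termOrder]
      rw [mul_comm, mul_smul, norm_smul, mul_comm, norm_prod, ← Finset.prod_pow_eq_pow_sum]
      refine mul_le_mul ?_ ?_ (Finset.prod_nonneg fun _ _ => norm_nonneg _) hKpos.le
      · refine (hK α.1 y hy).trans ?_
        have := Finset.single_le_sum (fun α _ => hK₀ α) α.2
        linarith
      · refine Finset.prod_le_prod (fun _ _ => norm_nonneg _) fun a _ => ?_
        rw [norm_pow]
        exact pow_le_pow_left₀ (norm_nonneg _) ((norm_le_pi_norm _ a).trans (hnorm i)) _
  have hexp : (Matrix.of fun i => G (w i)).det =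
      ∑ r : Fin (d + 1) → Option (multiIdx k n), (Matrix.of fun i => g i (r i)).det := by
    have := (Matrix.detRowAlternating (R := ℝ) (n := Fin (d + 1))).toMultilinearMap.map_sum
      (g := g)
    have e : (fun i => G (w i)) = fun i => ∑ o, g i o := funext hsum
    rw [e]
    exact this
  have hterm : ∀ r : Fin (d + 1) → Option (multiIdx k n),
      |(Matrix.of fun i => g i (r i)).det| ≤ ((d + 1).factorial * K ^ (d + 1)) * ρ ^ Nkd k d := by
    intro r
    by_cases hr : ∀ i j α, r i = some α → r j = some α → i = j
    · refine (abs_det_le_of_row_bounds _ (fun i => K * ρ ^ termOrder (r i)) fun i j => ?_).trans ?_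
      · exact (norm_le_pi_norm (g i (r i)) j).trans (hg i (r i))
      · rw [Finset.prod_mul_distrib, Finset.prod_pow_eq_pow_sum, Finset.prod_const,
          Finset.card_univ, Fintype.card_fin, mul_assoc]
        have := pow_le_pow_of_le_one hρ.le hρ1 (Nkd_le_sum_termOrder hk r hr)
        gcongr
    · push Not at hr
      obtain ⟨i, j, α, hi, hj, hij⟩ := hr
      have hzero : (Matrix.of fun i => g i (r i)).det = 0 := by
        set M := Matrix.of fun i => g i (r i)
        have hrow : ∀ i, r i = some α → M i =
            (taylorWeight α.1 * ∏ a, (w i - y) a ^ α.1 a) • mderiv α.1 G y := by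
          intro i hi
          change g i (r i) = _
          rw [hi]
        have hi := hrow i hi
        have hj := hrow j hj
        set p := taylorWeight α.1 * ∏ a, (w i - y) a ^ α.1 a
        set q := taylorWeight α.1 * ∏ a, (w j - y) a ^ α.1 a
        by_cases hp : p = 0
        · exact Matrix.det_eq_zero_of_row_eq_zero i fun l => by rw [hi, hp]; simp
        · have hM : M = M.updateRow j ((q / p) • M i) := by
            rw [hi, smul_smul, div_mul_cancel₀ _ hp, ← hj, Matrix.updateRow_eq_self]
          rw [hM, Matrix.det_updateRow_smul, Matrix.det_updateRow_eq_zero hij, mul_zero]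
      rw [hzero, abs_zero]
      positivity
  rw [hexp]
  refine (Finset.abs_sum_le_sum_abs _ _).trans ((Finset.sum_le_sum fun r _ => hterm r).trans ?_)
  rw [Finset.sum_const, nsmul_eq_mul, Finset.card_univ]
  have : 0 ≤ ρ ^ Nkd k d := by positivity
  nlinarith

end Determinant

section Rational

variable {d : ℕ}

theorem ht_spec {r : Fin d → ℝ} (hr : IsRatPt r) :
    0 < ht r ∧ ∀ i, ∃ m : ℤ, (ht r : ℝ) * r i = m := by
  refine Nat.sInf_mem (s := {q : ℕ | 0 < q ∧ ∀ i, ∃ m : ℤ, (q : ℝ) * r i = (m : ℝ)}) ?_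
  choose a ha using hr
  refine ⟨∏ i, (a i).den, Finset.prod_pos fun i _ => (a i).pos, fun i => ?_⟩
  refine ⟨(∏ j ∈ Finset.univ.erase i, (a j).den : ℕ) * (a i).num, ?_⟩
  rw [ha i, ← Finset.prod_erase_mul _ _ (Finset.mem_univ i)]
  have h : ((a i).den : ℝ) * (a i : ℝ) = (a i).num := by
    exact_mod_cast Rat.den_mul_eq_num (a i)
  push_cast
  rw [mul_assoc, h]

theorem one_le_abs_det_mul_prod_ht (r : Fin (d + 1) → Fin d → ℝ) (hr : ∀ i, IsRatPt (r i))
    (hdet : (Matrix.of fun i => (Fin.cons 1 (r i) : Fin (d + 1) → ℝ)).det ≠ 0) :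
    1 ≤ (∏ i, (ht (r i) : ℝ)) *
      |(Matrix.of fun i => (Fin.cons 1 (r i) : Fin (d + 1) → ℝ)).det| := by
  have hcoord : ∀ i j, ∃ m : ℤ, (ht (r i) : ℝ) * (Fin.cons 1 (r i) : Fin (d + 1) → ℝ) j = m := by
    intro i j
    refine Fin.cases ⟨ht (r i), by simp⟩ (fun j => ?_) j
    simpa using (ht_spec (hr i)).2 j
  choose m hm using hcoord
  have h1 : (∏ i, (ht (r i) : ℝ)) *
      (Matrix.of fun i => (Fin.cons 1 (r i) : Fin (d + 1) → ℝ)).det =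
      ((Matrix.of m).det : ℤ) := by
    rw [← Matrix.det_mul_column, Int.cast_det]
    congr 1
    ext i j
    simp [hm]
  have hpos : 0 < ∏ i, (ht (r i) : ℝ) :=
    Finset.prod_pos fun i _ => by exact_mod_cast (ht_spec (hr i)).1
  rw [← abs_of_pos hpos, ← abs_mul, h1, ← Int.cast_abs]
  have : (Matrix.of m).det ≠ 0 := by
    intro h
    rw [h] at h1
    simp [hpos.ne', hdet] at h1
  exact_mod_cast Int.one_le_abs this

theorem finite_ratPt_ht_le (x : Fin d → ℝ) (T : ℕ) :
    {r : Fin d → ℝ | IsRatPt r ∧ ht r ≤ T ∧ ‖x - r‖ ≤ 1}.Finite := by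
  obtain ⟨X, hX⟩ := exists_nat_ge (‖x‖ + 1)
  refine Set.Finite.subset (s := ⋃ q ∈ Finset.range (T + 1),
    (fun m : Fin d → ℤ => fun i => (m i : ℝ) / q) ''
      (Finset.Icc (fun _ => -(T * X : ℤ)) (fun _ => (T * X : ℤ)) : Finset (Fin d → ℤ))) ?_ ?_
  · exact Set.Finite.biUnion (Finset.finite_toSet _) fun q _ => (Finset.finite_toSet _).image _
  · rintro r ⟨hr, hT, hx⟩
    obtain ⟨hpos, hm⟩ := ht_spec hr
    choose m hm using hm
    have hpos' : (0 : ℝ) < ht r := by exact_mod_cast hpos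
    simp only [mem_iUnion]
    refine ⟨ht r, Finset.mem_range.2 (by omega), m, ?_, ?_⟩
    · have hrX : ‖r‖ ≤ X := by
        have := norm_sub_norm_le r x
        rw [norm_sub_rev] at this
        linarith
      have hbd : ∀ i, |m i| ≤ (T * X : ℤ) := by
        intro i
        have h1 : |(m i : ℝ)| ≤ T * X := by
          rw [← hm i, abs_mul, abs_of_pos hpos']
          have h2 : |r i| ≤ X := (norm_le_pi_norm r i).trans hrX
          have h3 : (ht r : ℝ) ≤ T := by exact_mod_cast hT
          gcongr
        exact_mod_cast h1
      simp only [Finset.coe_Icc, mem_Icc]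
      exact ⟨fun i => (abs_le.1 (hbd i)).1, fun i => (abs_le.1 (hbd i)).2⟩
    · ext i
      simp only
      rw [← hm i]
      field_simp

/-- Rational points of bounded height in a small piece of a smooth manifold lie on
a hyperplane. -/
theorem exists_hyperplane_of_small_ball {k : ℕ} (hk : 1 ≤ k) {F : (Fin k → ℝ) → (Fin d → ℝ)}
    (hF : ContDiff ℝ (⊤ : ℕ∞) F) (v : Fin k → ℝ) (R : ℝ) :
    ∃ κ : ℝ, 0 < κ ∧ ∀ y ρ T, 0 < ρ → ρ ≤ 1 → 0 ≤ T → closedBall y ρ ⊆ closedBall v R →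
      ρ ^ Nkd k d * T ^ (d + 1) ≤ κ →
      ∃ c : Fin (d + 1) → ℝ, c ≠ 0 ∧ ∀ w ∈ closedBall y ρ, IsRatPt (F w) → (ht (F w) : ℝ) ≤ T →
        ∑ i, c i * (Fin.cons 1 (F w) : Fin (d + 1) → ℝ) i = 0 := by
  have hG : ContDiff ℝ (⊤ : ℕ∞) (fun w => (Fin.cons 1 (F w) : Fin (d + 1) → ℝ)) := by
    rw [contDiff_pi]
    intro i
    refine Fin.cases ?_ (fun j => ?_) i
    · simpa using contDiff_const
    · simpa using contDiff_pi.1 hF j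
  obtain ⟨C, hC, hdet⟩ := exists_det_bound hk hG v R
  refine ⟨1 / (2 * C), by positivity, fun y ρ T hρ hρ1 hT hsub hsmall => ?_⟩
  set s : Set (Fin (d + 1) → ℝ) := {z | ∃ w ∈ closedBall y ρ, IsRatPt (F w) ∧ (ht (F w) : ℝ) ≤ T ∧
    z = Fin.cons 1 (F w)} with hs
  have hspan : Submodule.span ℝ s < ⊤ := by
    rw [lt_top_iff_ne_top]
    intro htop
    obtain ⟨f, hf, -, hli⟩ := Submodule.exists_fun_fin_finrank_span_eq ℝ s
    have hfr : Module.finrank ℝ (Submodule.span ℝ s) = d + 1 := by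
      rw [htop, finrank_top, Module.finrank_fin_fun]
    obtain ⟨f', hf', hli'⟩ : ∃ f' : Fin (d + 1) → Fin (d + 1) → ℝ, (∀ i, f' i ∈ s) ∧
        LinearIndependent ℝ f' :=
      ⟨f ∘ Fin.cast hfr.symm, fun i => hf _, hli.comp _ (Fin.cast_injective _)⟩
    choose w hw hrat hht hfw using hf'
    have hne : (Matrix.of fun i => (Fin.cons 1 (F (w i)) : Fin (d + 1) → ℝ)).det ≠ 0 := by
      have : (Matrix.of fun i => (Fin.cons 1 (F (w i)) : Fin (d + 1) → ℝ)) = Matrix.of f' := by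
        ext i j; simp [hfw]
      rw [this]
      have := (Matrix.linearIndependent_rows_iff_isUnit (A := Matrix.of f')).1 hli'
      exact ((Matrix.isUnit_iff_isUnit_det _).1 this).ne_zero
    have h1 := one_le_abs_det_mul_prod_ht (fun i => F (w i)) hrat hne
    have h2 := hdet y ρ hρ hρ1 hsub w hw
    have h3 : ∏ i, (ht (F (w i)) : ℝ) ≤ T ^ (d + 1) := by
      refine (Finset.prod_le_prod (fun _ _ => Nat.cast_nonneg _) fun i _ => hht i).trans ?_
      simp
    have h4 := mul_le_mul h3 h2 (abs_nonneg _) (by positivity)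
    have h5 : T ^ (d + 1) * (C * ρ ^ Nkd k d) = C * (ρ ^ Nkd k d * T ^ (d + 1)) := by ring
    have h6 : C * (ρ ^ Nkd k d * T ^ (d + 1)) ≤ C * (1 / (2 * C)) := by gcongr
    have h7 : C * (1 / (2 * C)) = 1 / 2 := by field_simp
    linarith
  obtain ⟨φ, hφ, hker⟩ := Submodule.exists_le_ker_of_lt_top _ hspan
  have hφe : ∀ x, φ x = ∑ i, φ (Pi.single i 1) * x i := by
    intro x
    conv_lhs => rw [pi_eq_sum_univ' x, map_sum]
    exact Finset.sum_congr rfl fun i _ => by rw [map_smul, smul_eq_mul, mul_comm]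
  refine ⟨fun i => φ (Pi.single i 1), fun h0 => hφ ?_, fun w hw hr hht => ?_⟩
  · ext i
    simpa using congrFun h0 i
  · rw [← hφe]
    exact hker (Submodule.subset_span ⟨w, hw, hr, hht, rfl⟩)

end Rational

section Subcubes

variable {k : ℕ}

/-- The centers of the `m ^ k` cubes of radius `ρ / m` into which `closedBall y ρ` decomposes. -/
def subcenter (m : ℕ) (y : Fin k → ℝ) (ρ : ℝ) (i : Fin k → Fin m) : Fin k → ℝ :=
  fun a => y a + ρ * ((2 * (i a : ℝ) + 1) / m - 1)

theorem exists_mem_subcube {m : ℕ} (hm : 0 < m) {y x : Fin k → ℝ} {ρ : ℝ} (hρ : 0 < ρ)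
    (hx : x ∈ closedBall y ρ) : ∃ i, x ∈ closedBall (subcenter m y ρ i) (ρ / m) := by
  have hm' : (0 : ℝ) < m := by exact_mod_cast hm
  have h1 : ∀ a, ∃ i : Fin m, |x a - (y a + ρ * ((2 * (i : ℝ) + 1) / m - 1))| ≤ ρ / m := by
    intro a
    have hxa : |x a - y a| ≤ ρ := (dist_pi_le_iff hρ.le).1 hx a
    set t : ℝ := (x a - y a + ρ) * m / (2 * ρ) with ht
    have hxt : x a = y a + ρ * (2 * t / m - 1) := by
      rw [ht]; field_simp; ring
    have ht0 : 0 ≤ t := by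
      have := (abs_le.1 hxa).1
      exact div_nonneg (mul_nonneg (by linarith) hm'.le) (by linarith)
    have htm : t ≤ m := by
      have := (abs_le.1 hxa).2
      rw [ht, div_le_iff₀ (by linarith)]
      nlinarith
    obtain ⟨i, hi1, hi2⟩ : ∃ i : Fin m, (i : ℝ) ≤ t ∧ t ≤ i + 1 := by
      by_cases h : ⌊t⌋₊ < m
      · exact ⟨⟨⌊t⌋₊, h⟩, Nat.floor_le ht0, (Nat.lt_floor_add_one t).le⟩
      · have h2 : (m : ℝ) ≤ t := (Nat.le_floor_iff ht0).1 (not_lt.1 h)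
        refine ⟨⟨m - 1, by omega⟩, ?_, ?_⟩ <;> simp only [Nat.cast_sub hm] <;> push_cast <;>
          linarith
    refine ⟨i, ?_⟩
    have : x a - (y a + ρ * ((2 * (i : ℝ) + 1) / m - 1)) = ρ / m * (2 * (t - i) - 1) := by
      rw [hxt]; field_simp; ring
    rw [this, abs_mul, abs_of_pos (div_pos hρ hm')]
    refine mul_le_of_le_one_right (div_pos hρ hm').le (abs_le.2 ⟨?_, ?_⟩) <;> linarith
  choose i hi using h1
  exact ⟨i, (dist_pi_le_iff (div_pos hρ hm').le).2 hi⟩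

theorem subcube_subset {m : ℕ} (hm : 0 < m) (y : Fin k → ℝ) {ρ : ℝ} (hρ : 0 < ρ)
    (i : Fin k → Fin m) : closedBall (subcenter m y ρ i) (ρ / m) ⊆ closedBall y ρ := by
  have hm' : (0 : ℝ) < m := by exact_mod_cast hm
  intro x hx
  rw [mem_closedBall, dist_pi_le_iff hρ.le]
  intro a
  have h1 : |x a - subcenter m y ρ i a| ≤ ρ / m := (dist_pi_le_iff (div_pos hρ hm').le).1 hx a
  have hi : ((i a : ℕ) : ℝ) + 1 ≤ m := by exact_mod_cast (i a).2
  have h2 : |subcenter m y ρ i a - y a| ≤ ρ - ρ / m := by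
    have e : subcenter m y ρ i a - y a = ρ / m * (2 * (i a : ℝ) + 1 - m) := by
      unfold subcenter; field_simp; ring
    have e2 : ρ - ρ / m = ρ / m * (m - 1) := by field_simp
    rw [e, e2, abs_mul, abs_of_pos (div_pos hρ hm')]
    gcongr
    have : (0 : ℝ) ≤ (i a : ℕ) := Nat.cast_nonneg _
    exact abs_le.2 ⟨by linarith, by linarith⟩
  rw [Real.dist_eq]
  have := abs_sub_le (x a) (subcenter m y ρ i a) (y a)
  linarith

theorem exists_cover_of_porous {m : ℕ} (hm : 0 < m) (Z : Set (Fin k → ℝ)) (s : ℕ)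
    (y : Fin k → ℝ) (ρ : ℝ) (hρ : 0 < ρ)
    (hZ : ∀ y' ρ', 0 < ρ' → ρ' ≤ ρ → closedBall y' ρ' ⊆ closedBall y ρ →
      ∃ i, ∀ w ∈ closedBall (subcenter m y' ρ' i) (ρ' / m), w ∉ Z) :
    ∃ T : Finset (Fin k → ℝ), T.card ≤ (m ^ k - 1) ^ s ∧
      ∀ w ∈ Z, w ∈ closedBall y ρ → ∃ t ∈ T, w ∈ closedBall t (ρ / m ^ s) := by
  classical
  have hm' : (1 : ℝ) ≤ m := by exact_mod_cast hm
  induction s generalizing y ρ with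
  | zero => exact ⟨{y}, by simp, fun w _ hw => ⟨y, by simp, by simpa using hw⟩⟩
  | succ s ih =>
    obtain ⟨i₀, hi₀⟩ := hZ y ρ hρ le_rfl subset_rfl
    have hρm : ρ / m ≤ ρ := div_le_self hρ.le hm'
    have hρm0 : 0 < ρ / m := div_pos hρ (by linarith)
    choose T hTc hT using fun i => ih (subcenter m y ρ i) (ρ / m) hρm0
      fun y' ρ' h1 h2 h3 => hZ y' ρ' h1 (h2.trans hρm) (h3.trans (subcube_subset hm y hρ i))
    refine ⟨(Finset.univ.erase i₀).biUnion T, ?_, fun w hwZ hw => ?_⟩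
    · refine (Finset.card_biUnion_le_card_mul _ _ _ fun i _ => hTc i).trans (le_of_eq ?_)
      rw [Finset.card_erase_of_mem (Finset.mem_univ _), Finset.card_univ, Fintype.card_fun,
        Fintype.card_fin, Fintype.card_fin, pow_succ']
    · obtain ⟨i, hi⟩ := exists_mem_subcube hm hρ hw
      have hne : i ≠ i₀ := by
        rintro rfl
        exact hi₀ w hi hwZ
      obtain ⟨t, ht, hwt⟩ := hT i w hwZ hi
      refine ⟨t, Finset.mem_biUnion.2 ⟨i, by simp [hne], ht⟩, ?_⟩
      rwa [div_div, ← pow_succ'] at hwt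

end Subcubes

section Polynomials

variable {k : ℕ}

/-- The polynomial function with coefficients `p`. -/
def polyFun {D : ℕ} (p : multiIdx k D → ℝ) (u : Fin k → ℝ) : ℝ :=
  ∑ α, p α * ∏ a, u a ^ α.1 a

theorem continuous_polyFun {D : ℕ} (p : multiIdx k D → ℝ) : Continuous (polyFun p) := by
  unfold polyFun
  fun_prop

theorem eq_zero_of_polyFun_eq_zero {D : ℕ} (p : multiIdx k D → ℝ)
    (hp : ∀ u ∈ closedBall (0 : Fin k → ℝ) 1, polyFun p u = 0) : p = 0 := by
  classical
  set P : MvPolynomial (Fin k) ℝ :=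
    ∑ α, MvPolynomial.monomial (Finsupp.equivFunOnFinite.symm α.1) (p α) with hP
  have heval : ∀ u, MvPolynomial.eval u P = polyFun p u := by
    intro u
    simp [hP, polyFun, MvPolynomial.eval_monomial, Finsupp.prod_fintype]
  have hP0 : P = 0 := by
    refine MvPolynomial.funext_set (fun _ => Icc (-1 : ℝ) 1)
      (fun _ => Icc_infinite (by norm_num)) fun u hu => ?_
    rw [heval, map_zero]
    refine hp u ?_
    rw [mem_closedBall, dist_pi_le_iff zero_le_one]
    intro a
    simpa [abs_le] using hu a (mem_univ a)
  ext α
  have : MvPolynomial.coeff (Finsupp.equivFunOnFinite.symm α.1) P = p α := by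
    rw [hP, MvPolynomial.coeff_sum, Finset.sum_eq_single α]
    · simp
    · intro β _ hβ
      rw [MvPolynomial.coeff_monomial, if_neg]
      intro h
      exact hβ (Subtype.ext (Finsupp.equivFunOnFinite.symm.injective h))
    · simp
  rw [← this, hP0]; simp

theorem exists_polyFun_lower_bound (k D : ℕ) :
    ∃ c > (0 : ℝ), ∃ δ > (0 : ℝ), ∀ p : multiIdx k D → ℝ, ∃ u₀ ∈ closedBall (0 : Fin k → ℝ) 1,
      ∀ u ∈ closedBall (0 : Fin k → ℝ) 1, dist u u₀ ≤ δ → c * ‖p‖ ≤ |polyFun p u| := by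
  have hcomp : IsCompact (closedBall (0 : Fin k → ℝ) 1) := isCompact_closedBall _ _
  have : CompactSpace (closedBall (0 : Fin k → ℝ) 1) := isCompact_iff_compactSpace.1 hcomp
  let T : (multiIdx k D → ℝ) →ₗ[ℝ] C(closedBall (0 : Fin k → ℝ) 1, ℝ) :=
    { toFun := fun p => ⟨fun u => polyFun p u, (continuous_polyFun p).comp continuous_subtype_val⟩
      map_add' := fun p q => by
        ext u; simp [polyFun, add_mul, Finset.sum_add_distrib]
      map_smul' := fun c p => by
        ext u; simp [polyFun, mul_assoc, Finset.mul_sum] }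
  obtain ⟨K, hK, hT⟩ := T.exists_antilipschitzWith (LinearMap.ker_eq_bot'.2 fun p hp =>
    eq_zero_of_polyFun_eq_zero p fun u hu => by
      simpa [T] using DFunLike.congr_fun hp ⟨u, hu⟩)
  have hK' : (0 : ℝ) < K := hK
  have hlow : ∀ p : multiIdx k D → ℝ, ∃ u₀ ∈ closedBall (0 : Fin k → ℝ) 1,
      ‖p‖ ≤ K * |polyFun p u₀| := by
    intro p
    obtain ⟨u₀, hu₀, hmax⟩ := hcomp.exists_isMaxOn (nonempty_closedBall.2 zero_le_one)
      (continuous_polyFun p).abs.continuousOn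
    refine ⟨u₀, hu₀, ?_⟩
    have h1 : ‖p‖ ≤ K * ‖T p‖ := by simpa using hT.le_mul_dist p 0
    have h2 : ‖T p‖ ≤ |polyFun p u₀| :=
      (ContinuousMap.norm_le _ (abs_nonneg _)).2 fun u => hmax u.2
    exact h1.trans (by gcongr)
  set η : ℝ := 1 / (2 * K * ((multiIdx k D).card + 1)) with hη
  have hη0 : 0 < η := by positivity
  have hunif : ∀ α : multiIdx k D, ∃ δ > (0 : ℝ), ∀ u ∈ closedBall (0 : Fin k → ℝ) 1,
      ∀ u' ∈ closedBall (0 : Fin k → ℝ) 1, dist u u' ≤ δ →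
        |∏ a, u a ^ α.1 a - ∏ a, u' a ^ α.1 a| ≤ η := by
    intro α
    have hc : Continuous fun u : Fin k → ℝ => ∏ a, u a ^ α.1 a := by fun_prop
    have := hcomp.uniformContinuousOn_of_continuous hc.continuousOn
    obtain ⟨δ, hδ, h⟩ := Metric.uniformContinuousOn_iff_le.1 this η hη0
    exact ⟨δ, hδ, fun u hu u' hu' hd => h u hu u' hu' hd⟩
  choose δ hδ0 hδ using hunif
  obtain ⟨δ₀, hδ₀, hδ₀le⟩ : ∃ δ₀ > (0 : ℝ), ∀ α, δ₀ ≤ δ α := by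
    have : ∀ᶠ t in nhdsWithin (0 : ℝ) (Ioi 0), ∀ α, t ≤ δ α :=
      Filter.eventually_all.2 fun α =>
        (eventually_nhdsWithin_of_eventually_nhds (Iic_mem_nhds (hδ0 α)))
    obtain ⟨t, ht, ht0⟩ := (this.and self_mem_nhdsWithin).exists
    exact ⟨t, ht0, ht⟩
  refine ⟨1 / (2 * K), by positivity, δ₀, hδ₀, fun p => ?_⟩
  obtain ⟨u₀, hu₀, hp⟩ := hlow p
  refine ⟨u₀, hu₀, fun u hu hd => ?_⟩
  have hdiff : |polyFun p u₀ - polyFun p u| ≤ (multiIdx k D).card * (‖p‖ * η) := by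
    unfold polyFun
    rw [← Finset.sum_sub_distrib]
    refine (Finset.abs_sum_le_sum_abs _ _).trans ?_
    refine (Finset.sum_le_card_nsmul _ _ (‖p‖ * η) fun α _ => ?_).trans (by simp)
    rw [← mul_sub, abs_mul, abs_sub_comm]
    exact mul_le_mul (norm_le_pi_norm p α) (hδ α u hu u₀ hu₀ (hd.trans (hδ₀le α)))
      (abs_nonneg _) (norm_nonneg _)
  have h1 : (multiIdx k D).card * (‖p‖ * η) ≤ 1 / (2 * K) * ‖p‖ := by
    have : (multiIdx k D).card * η ≤ 1 / (2 * K) := by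
      rw [hη, mul_one_div, div_le_div_iff₀ (by positivity) (by positivity)]
      nlinarith
    calc (multiIdx k D).card * (‖p‖ * η) = ((multiIdx k D).card * η) * ‖p‖ := by ring
      _ ≤ _ := by gcongr
  have h2 : ‖p‖ / K ≤ |polyFun p u₀| := by rw [div_le_iff₀ hK']; linarith
  have h3 : ‖p‖ / K = 1 / (2 * K) * ‖p‖ + 1 / (2 * K) * ‖p‖ := by field_simp; ring
  have h4 := abs_sub_abs_le_abs_sub (polyFun p u₀) (polyFun p u)
  linarith

end Polynomials

section Porosity

variable {k d : ℕ}

/-- Near a nondegenerate point, some Taylor coefficient of order between `1` and `D` of every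
linear combination `∑ j, a j * F · j` is bounded below by a multiple of `‖a‖`. -/
theorem exists_taylorCoeff_lower_bound {F : (Fin k → ℝ) → Fin d → ℝ}
    (hF : ContDiff ℝ (⊤ : ℕ∞) F) {D : ℕ} {v : Fin k → ℝ}
    (hspan : Submodule.span ℝ {y : Fin d → ℝ | ∃ α : Fin k → ℕ,
      0 < (∑ j, α j) ∧ (∑ j, α j) ≤ D ∧ y = mderiv α F v} = ⊤) :
    ∃ c > (0 : ℝ), ∃ r > (0 : ℝ), ∀ x ∈ closedBall v r, ∀ a : Fin d → ℝ, a ≠ 0 →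
      ∃ α ∈ multiIdx k D, α ≠ 0 ∧ c * ‖a‖ ≤ |taylorWeight α * ∑ j, a j * mderiv α F x j| := by
  classical
  let S := {α : multiIdx k D // α.1 ≠ 0}
  let T : (Fin d → ℝ) →ₗ[ℝ] (S → ℝ) :=
    { toFun := fun a α => taylorWeight α.1.1 * ∑ j, a j * mderiv α.1.1 F v j
      map_add' := fun a b => by
        ext α; simp [add_mul, Finset.sum_add_distrib, mul_add]
      map_smul' := fun c a => by
        ext α; simp only [Pi.smul_apply, smul_eq_mul, mul_assoc, ← Finset.mul_sum,
          RingHom.id_apply]; ring }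
  have hker : T.ker = ⊥ := by
    refine LinearMap.ker_eq_bot'.2 fun a ha => ?_
    let L : (Fin d → ℝ) →ₗ[ℝ] ℝ := ∑ j, a j • LinearMap.proj j
    have hL : ∀ y, L y = ∑ j, a j * y j := fun y => by simp [L]
    have hL0 : L = 0 := by
      refine LinearMap.ext_on_range (v := fun y : {y : Fin d → ℝ | ∃ α : Fin k → ℕ,
        0 < (∑ j, α j) ∧ (∑ j, α j) ≤ D ∧ y = mderiv α F v} => (y : Fin d → ℝ))
        (by rw [Subtype.range_coe]; exact hspan) ?_
      rintro ⟨y, α, h0, h1, rfl⟩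
      have hα : α ≠ 0 := by rintro rfl; simp at h0
      have := congrFun ha ⟨⟨α, mem_multiIdx.2 h1⟩, hα⟩
      have h2 : taylorWeight α * ∑ j, a j * mderiv α F v j = 0 := this
      rw [LinearMap.zero_apply, hL]
      exact (mul_eq_zero.1 h2).resolve_left (taylorWeight_ne_zero α)
    ext j
    have := hL (Pi.single j 1)
    rw [hL0] at this
    simpa [Pi.single_apply] using this.symm
  obtain ⟨K, hK, hT⟩ := T.exists_antilipschitzWith hker
  have hK' : (0 : ℝ) < K := hK
  have hcont : ∀ α : multiIdx k D, ∀ᶠ x in nhds v,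
      |taylorWeight α.1| * ‖mderiv α.1 F x - mderiv α.1 F v‖ < 1 / (4 * K * (d + 1)) := by
    intro α
    have hc : Continuous fun x => |taylorWeight α.1| * ‖mderiv α.1 F x - mderiv α.1 F v‖ := by
      have := (contDiff_mderiv hF α.1).continuous
      fun_prop
    refine hc.continuousAt.eventually_lt continuousAt_const ?_
    simp only [sub_self, norm_zero, mul_zero]
    positivity
  obtain ⟨r, hr, hball⟩ := Metric.nhds_basis_closedBall.eventually_iff.1
    (Filter.eventually_all.2 hcont)
  refine ⟨1 / (4 * K), by positivity, r, hr, fun x hx a ha => ?_⟩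
  have ha' : 0 < ‖a‖ := norm_pos_iff.2 ha
  have h1 : ‖a‖ ≤ K * ‖T a‖ := by
    have := hT.le_mul_dist a 0
    rwa [map_zero, dist_zero_right, dist_zero_right] at this
  obtain ⟨α, hα⟩ : ∃ α : S, ‖a‖ / (2 * K) < |T a α| := by
    by_contra! h
    have h2 : ‖T a‖ ≤ ‖a‖ / (2 * K) := (pi_norm_le_iff_of_nonneg (by positivity)).2 h
    have h3 : K * ‖T a‖ ≤ K * (‖a‖ / (2 * K)) := by gcongr
    have h4 : (K : ℝ) * (‖a‖ / (2 * K)) = ‖a‖ / 2 := by field_simp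
    linarith
  refine ⟨α.1.1, α.1.2, α.2, ?_⟩
  have hTa : T a α = taylorWeight α.1.1 * ∑ j, a j * mderiv α.1.1 F v j := rfl
  have hdiff : |T a α - taylorWeight α.1.1 * ∑ j, a j * mderiv α.1.1 F x j| ≤
      1 / (4 * K) * ‖a‖ := by
    rw [hTa, ← mul_sub, ← Finset.sum_sub_distrib, abs_mul]
    have h5 : |∑ j, (a j * mderiv α.1.1 F v j - a j * mderiv α.1.1 F x j)| ≤
        d * (‖a‖ * ‖mderiv α.1.1 F x - mderiv α.1.1 F v‖) := by
      refine (Finset.abs_sum_le_sum_abs _ _).trans ?_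
      refine (Finset.sum_le_card_nsmul _ _ (‖a‖ * ‖mderiv α.1.1 F x - mderiv α.1.1 F v‖)
        fun j _ => ?_).trans (by simp)
      rw [← mul_sub, abs_mul, abs_sub_comm]
      exact mul_le_mul (norm_le_pi_norm a j)
        (norm_le_pi_norm (mderiv α.1.1 F x - mderiv α.1.1 F v) j) (abs_nonneg _) (norm_nonneg _)
    have h6 := hball hx α.1
    calc |taylorWeight α.1.1| * |∑ j, (a j * mderiv α.1.1 F v j - a j * mderiv α.1.1 F x j)|
        ≤ |taylorWeight α.1.1| * (d * (‖a‖ * ‖mderiv α.1.1 F x - mderiv α.1.1 F v‖)) := by gcongr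
      _ = d * ‖a‖ * (|taylorWeight α.1.1| * ‖mderiv α.1.1 F x - mderiv α.1.1 F v‖) := by ring
      _ ≤ d * ‖a‖ * (1 / (4 * K * (d + 1))) := by gcongr
      _ = 1 / (4 * K) * ‖a‖ * (d / (d + 1)) := by field_simp
      _ ≤ 1 / (4 * K) * ‖a‖ := by
        refine mul_le_of_le_one_right (by positivity) ?_
        rw [div_le_one (by positivity)]; linarith
  have h7 := abs_sub_abs_le_abs_sub (T a α)
    (taylorWeight α.1.1 * ∑ j, a j * mderiv α.1.1 F x j)
  have h8 : ‖a‖ / (2 * K) = 1 / (4 * K) * ‖a‖ + 1 / (4 * K) * ‖a‖ := by field_simp; ring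
  linarith

theorem exists_zero_free_subcube {F : (Fin k → ℝ) → Fin d → ℝ}
    (hF : ContDiff ℝ (⊤ : ℕ∞) F) {D : ℕ} {v : Fin k → ℝ}
    (hspan : Submodule.span ℝ {y : Fin d → ℝ | ∃ α : Fin k → ℕ,
      0 < (∑ j, α j) ∧ (∑ j, α j) ≤ D ∧ y = mderiv α F v} = ⊤) :
    ∃ R > (0 : ℝ), ∃ m : ℕ, 1 < m ∧ ∀ y ρ, 0 < ρ → closedBall y ρ ⊆ closedBall v R →
      ρ ≤ R → ∀ c : Fin (d + 1) → ℝ, c ≠ 0 → ∃ i : Fin k → Fin m,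
        ∀ w ∈ closedBall (subcenter m y ρ i) (ρ / m),
          ∑ i, c i * (Fin.cons 1 (F w) : Fin (d + 1) → ℝ) i ≠ 0 := by
  classical
  obtain ⟨c₀, hc₀, r, hr, hcoeff⟩ := exists_taylorCoeff_lower_bound hF hspan
  obtain ⟨c₁, hc₁, δ, hδ, hpoly⟩ := exists_polyFun_lower_bound k D
  obtain ⟨C, hC, htaylor⟩ := exists_taylor_bound hF v 1 D
  obtain ⟨m, hm⟩ := exists_nat_ge (2 / δ + 2)
  have hm1 : 1 < m := by
    have : (1 : ℝ) < m := lt_of_lt_of_le (by linarith [show 0 < 2 / δ by positivity]) hm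
    exact_mod_cast this
  have hm0 : 0 < m := one_pos.trans hm1
  have hm0' : (0 : ℝ) < m := by exact_mod_cast hm0
  replace hm : 2 / δ ≤ m := by linarith
  have hmδ : 1 / (m : ℝ) + 1 / m ≤ δ := by
    rw [← add_div, div_le_iff₀ hm0']
    rw [div_le_iff₀ hδ] at hm
    linarith
  refine ⟨min 1 (min r (c₁ * c₀ / (2 * (d * C + 1)))), by positivity, m, hm1,
    fun y ρ hρ hsub hρR c hc => ?_⟩
  have hρ1 : ρ ≤ 1 := hρR.trans (min_le_left _ _)
  have hρC : d * C * ρ < c₁ * c₀ := by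
    have h1 : ρ ≤ c₁ * c₀ / (2 * (d * C + 1)) :=
      hρR.trans ((min_le_right _ _).trans (min_le_right _ _))
    rw [le_div_iff₀ (by positivity)] at h1
    have : 0 ≤ d * C * ρ := by positivity
    nlinarith
  have hsub1 : closedBall y ρ ⊆ closedBall v 1 :=
    hsub.trans (closedBall_subset_closedBall (min_le_left _ _))
  have hyr : y ∈ closedBall v r := closedBall_subset_closedBall
    ((min_le_right _ _).trans (min_le_left _ _)) (hsub (mem_closedBall_self hρ.le))
  set a : Fin d → ℝ := fun j => c j.succ with ha
  have hsum : ∀ w, ∑ i, c i * (Fin.cons 1 (F w) : Fin (d + 1) → ℝ) i =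
      c 0 + ∑ j, a j * F w j := by
    intro w
    simp [Fin.sum_univ_succ, ha]
  by_cases ha0 : a = 0
  · refine ⟨fun _ => ⟨0, hm0⟩, fun w _ h => hc ?_⟩
    rw [hsum, ha0] at h
    ext i
    refine Fin.cases ?_ (fun j => congrFun ha0 j) i
    simpa using h
  have ha' : 0 < ‖a‖ := norm_pos_iff.2 ha0
  set p : multiIdx k D → ℝ := fun α => ρ ^ (∑ i, α.1 i) *
    (taylorWeight α.1 * ∑ j, a j * mderiv α.1 F y j) + if α.1 = 0 then c 0 else 0 with hp
  obtain ⟨u₀, hu₀, hlow⟩ := hpoly p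
  have hp_low : ρ ^ D * (c₀ * ‖a‖) ≤ ‖p‖ := by
    obtain ⟨α, hα, hα0, hle⟩ := hcoeff y hyr a ha0
    refine le_trans ?_ (norm_le_pi_norm p ⟨α, hα⟩)
    simp only [hp, hα0, if_false, add_zero, Real.norm_eq_abs, abs_mul (ρ ^ _)]
    rw [abs_of_nonneg (pow_nonneg hρ.le _)]
    have := pow_le_pow_of_le_one hρ.le hρ1 (mem_multiIdx.1 hα)
    gcongr
  obtain ⟨i, hi⟩ := exists_mem_subcube hm0 one_pos hu₀
  refine ⟨i, fun w hw => ?_⟩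
  set u : Fin k → ℝ := ρ⁻¹ • (w - y) with hu
  have hw_eq : w = y + ρ • u := by
    rw [hu, smul_smul, mul_inv_cancel₀ hρ.ne', one_smul, add_sub_cancel]
  have hui : u ∈ closedBall (subcenter m 0 1 i) (1 / m) := by
    have e : subcenter m y ρ i = y + ρ • subcenter m 0 1 i := by
      ext j; simp [subcenter]
    rw [mem_closedBall, e, hw_eq, dist_add_left, dist_smul₀, Real.norm_of_nonneg hρ.le,
      div_eq_mul_one_div] at hw
    exact le_of_mul_le_mul_left hw hρ
  have hu1 : u ∈ closedBall (0 : Fin k → ℝ) 1 := subcube_subset hm0 0 one_pos i hui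
  have huδ : dist u u₀ ≤ δ := (dist_triangle_right _ _ _).trans ((add_le_add hui hi).trans hmδ)
  have h1 := hlow u hu1 huδ
  have hwy : y + ρ • u ∈ closedBall y ρ := hw_eq ▸ subcube_subset hm0 y hρ i hw
  have hnorm : ‖ρ • u‖ ≤ ρ := by simpa using hwy
  have h2 := htaylor y (hsub1 (mem_closedBall_self hρ.le)) (ρ • u) (hsub1 hwy)
  set e : Fin d → ℝ := F (y + ρ • u) -
    ∑ α ∈ multiIdx k D, (taylorWeight α * ∏ a, (ρ • u) a ^ α a) • mderiv α F y with he
  have h3 : |∑ j, a j * e j| ≤ d * (‖a‖ * (C * ρ ^ (D + 1))) := by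
    refine (Finset.abs_sum_le_sum_abs _ _).trans ?_
    refine (Finset.sum_le_card_nsmul _ _ (‖a‖ * (C * ρ ^ (D + 1))) fun j _ => ?_).trans (by simp)
    rw [abs_mul]
    have : |e j| ≤ C * ρ ^ (D + 1) := (norm_le_pi_norm e j).trans (h2.trans (by gcongr))
    exact mul_le_mul (norm_le_pi_norm a j) this (abs_nonneg _) (norm_nonneg _)
  have h4 : c 0 + ∑ j, a j * F w j = polyFun p u + ∑ j, a j * e j := by
    have h5 : polyFun p u = c 0 + ∑ α ∈ multiIdx k D,
        (taylorWeight α * ∏ a, (ρ • u) a ^ α a) * ∑ j, a j * mderiv α F y j := by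
      have h0 : (0 : Fin k → ℕ) ∈ multiIdx k D := mem_multiIdx.2 (by simp)
      simp only [polyFun, hp, add_mul, Finset.sum_add_distrib]
      rw [add_comm]
      congr 1
      · rw [Finset.sum_eq_single ⟨0, h0⟩]
        · simp
        · intro β _ hβ
          rw [if_neg fun h => hβ (Subtype.ext h), zero_mul]
        · simp
      · rw [← Finset.sum_coe_sort (multiIdx k D)]
        refine Finset.sum_congr rfl fun α _ => ?_
        simp only [Pi.smul_apply, smul_eq_mul, mul_pow, Finset.prod_mul_distrib,
          Finset.prod_pow_eq_pow_sum]
        ring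
    have h6 : ∑ j, a j * e j = ∑ j, a j * F w j - ∑ α ∈ multiIdx k D,
        (taylorWeight α * ∏ a, (ρ • u) a ^ α a) * ∑ j, a j * mderiv α F y j := by
      simp only [he, ← hw_eq, Pi.sub_apply, Finset.sum_apply, Pi.smul_apply, smul_eq_mul, mul_sub,
        Finset.sum_sub_distrib, Finset.mul_sum]
      congr 1
      rw [Finset.sum_comm]
      refine Finset.sum_congr rfl fun α _ => Finset.sum_congr rfl fun j _ => ?_
      ring
    rw [h5, h6]; ring
  rw [hsum, h4]
  intro h0
  have h7 : |polyFun p u| = |∑ j, a j * e j| := by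
    rw [eq_neg_of_add_eq_zero_left h0, abs_neg]
  have h8 : c₁ * (ρ ^ D * (c₀ * ‖a‖)) ≤ d * (‖a‖ * (C * ρ ^ (D + 1))) := by
    calc _ ≤ c₁ * ‖p‖ := by gcongr
      _ ≤ _ := h1.trans (h7.trans_le h3)
  have h9 : 0 < ρ ^ D * ‖a‖ := by positivity
  have h10 : c₁ * c₀ * (ρ ^ D * ‖a‖) ≤ d * C * ρ * (ρ ^ D * ‖a‖) := by
    calc _ = c₁ * (ρ ^ D * (c₀ * ‖a‖)) := by ring
      _ ≤ _ := h8
      _ = _ := by ring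
  exact absurd (le_of_mul_le_mul_right h10 h9) (not_le.2 hρC)

end Porosity

section MeasureEstimate

variable {k d : ℕ}

theorem volume_nhd_ratPt_le {F : (Fin k → ℝ) → Fin d → ℝ} {v : Fin k → ℝ} {R κ : ℝ} (hR : 0 < R)
    (hR1 : R ≤ 1)
    (hplane : ∀ y ρ T, 0 < ρ → ρ ≤ 1 → 0 ≤ T → closedBall y ρ ⊆ closedBall v R →
      ρ ^ Nkd k d * T ^ (d + 1) ≤ κ → ∃ c : Fin (d + 1) → ℝ, c ≠ 0 ∧ ∀ w ∈ closedBall y ρ,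
        IsRatPt (F w) → (ht (F w) : ℝ) ≤ T →
          ∑ i, c i * (Fin.cons 1 (F w) : Fin (d + 1) → ℝ) i = 0)
    {m : ℕ} (hm : 0 < m)
    (hporous : ∀ y ρ, 0 < ρ → closedBall y ρ ⊆ closedBall v R →
      ρ ≤ R → ∀ c : Fin (d + 1) → ℝ, c ≠ 0 → ∃ i : Fin k → Fin m,
        ∀ w ∈ closedBall (subcenter m y ρ i) (ρ / m),
          ∑ i, c i * (Fin.cons 1 (F w) : Fin (d + 1) → ℝ) i ≠ 0)
    {T : ℝ} (hT : 0 ≤ T) {p : ℕ} (hp : 0 < p) (hpT : (R / p) ^ Nkd k d * T ^ (d + 1) ≤ κ)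
    (s : ℕ) {K δ : ℝ} (hK : 0 ≤ K) (hδ : δ ≤ K * (R / p) / m ^ s) :
    volume {x | ∃ w ∈ closedBall v R, IsRatPt (F w) ∧ (ht (F w) : ℝ) ≤ T ∧ dist x w ≤ δ} ≤
      ENNReal.ofReal ((2 * (1 + K) * R) ^ k * (1 - 1 / (m : ℝ) ^ k) ^ s) := by
  classical
  have hp' : (1 : ℝ) ≤ p := by exact_mod_cast hp
  have hm' : (1 : ℝ) ≤ m := by exact_mod_cast hm
  set ρ := R / p with hρ
  have hρ0 : 0 < ρ := by positivity
  have hρR : ρ ≤ R := div_le_self hR.le hp'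
  have hcover : ∀ i : Fin k → Fin p, ∃ S : Finset (Fin k → ℝ), S.card ≤ (m ^ k - 1) ^ s ∧
      ∀ w, IsRatPt (F w) → (ht (F w) : ℝ) ≤ T → w ∈ closedBall (subcenter p v R i) ρ →
        ∃ t ∈ S, w ∈ closedBall t (ρ / m ^ s) := by
    intro i
    have hsub := subcube_subset hp v hR i
    obtain ⟨c, hc, hcz⟩ := hplane _ ρ T hρ0 (hρR.trans hR1) hT hsub hpT
    obtain ⟨S, hS, hS'⟩ := exists_cover_of_porous hm
      {w | ∑ i, c i * (Fin.cons 1 (F w) : Fin (d + 1) → ℝ) i = 0} s (subcenter p v R i) ρ hρ0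
      fun y' ρ' h1 h2 h3 => hporous y' ρ' h1 (h3.trans hsub) (h2.trans hρR) c hc
    exact ⟨S, hS, fun w h1 h2 h3 => hS' w (hcz w h3 h1 h2) h3⟩
  choose S hS hS' using hcover
  have hincl : {x | ∃ w ∈ closedBall v R, IsRatPt (F w) ∧ (ht (F w) : ℝ) ≤ T ∧ dist x w ≤ δ} ⊆
      ⋃ i ∈ (Finset.univ : Finset (Fin k → Fin p)), ⋃ t ∈ S i,
        closedBall t ((1 + K) * ρ / m ^ s) := by
    rintro x ⟨w, hw, h1, h2, h3⟩
    obtain ⟨i, hi⟩ := exists_mem_subcube hp hR hw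
    obtain ⟨t, ht, hwt⟩ := hS' i w h1 h2 hi
    refine mem_biUnion (Finset.mem_coe.2 (Finset.mem_univ i)) (mem_biUnion ht ?_)
    have e : (1 + K) * ρ / m ^ s = K * ρ / m ^ s + ρ / m ^ s := by ring
    rw [mem_closedBall, e]
    exact (dist_triangle x w t).trans (add_le_add (h3.trans hδ) hwt)
  have hvol : ∀ t : Fin k → ℝ, volume (closedBall t ((1 + K) * ρ / m ^ s)) =
      ENNReal.ofReal ((2 * ((1 + K) * ρ / m ^ s)) ^ k) := fun t => by
    rw [Real.volume_pi_closedBall _ (by positivity), Fintype.card_fin]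
  calc _ ≤ _ := measure_mono hincl
    _ ≤ ∑ i : Fin k → Fin p, ∑ t ∈ S i, volume (closedBall t ((1 + K) * ρ / m ^ s)) :=
      (measure_biUnion_finset_le _ _).trans
        (Finset.sum_le_sum fun i _ => measure_biUnion_finset_le _ _)
    _ ≤ ∑ i : Fin k → Fin p, ((m ^ k - 1) ^ s : ℕ) *
          ENNReal.ofReal ((2 * ((1 + K) * ρ / m ^ s)) ^ k) := by
      refine Finset.sum_le_sum fun i _ => ?_
      simp only [hvol, Finset.sum_const, nsmul_eq_mul]
      gcongr
      exact_mod_cast hS i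
    _ = ENNReal.ofReal ((p : ℝ) ^ k * (((m ^ k - 1) ^ s : ℕ) *
          (2 * ((1 + K) * ρ / m ^ s)) ^ k)) := by
      rw [Finset.sum_const, Finset.card_univ, Fintype.card_fun, Fintype.card_fin,
        Fintype.card_fin, nsmul_eq_mul, ENNReal.ofReal_mul (by positivity),
        ENNReal.ofReal_mul (by positivity), ENNReal.ofReal_natCast,
        ← Nat.cast_pow p k, ENNReal.ofReal_natCast]
    _ = _ := by
      congr 1
      have h1 : 1 ≤ m ^ k := Nat.one_le_pow _ _ hm
      have h2 : (1 : ℝ) - 1 / (m : ℝ) ^ k = ((m : ℝ) ^ k - 1) / (m : ℝ) ^ k := by field_simp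
      rw [h2, hρ]
      push_cast [h1]
      simp only [mul_pow, div_pow, ← pow_mul, mul_comm s k]
      field_simp

theorem exists_radius_volume_eq_zero (hk : 0 < k) (hd : 0 < d) {F : (Fin k → ℝ) → Fin d → ℝ}
    (hF : ContDiff ℝ (⊤ : ℕ∞) F) {D : ℕ} {v : Fin k → ℝ}
    (hspan : Submodule.span ℝ {y : Fin d → ℝ | ∃ α : Fin k → ℕ,
      0 < (∑ j, α j) ∧ (∑ j, α j) ≤ D ∧ y = mderiv α F v} = ⊤) :
    ∃ R₀ > (0 : ℝ), ∀ R > 0, R ≤ R₀ → ∀ C > 0, ∀ ε > 0,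
      volume {x | ∀ Q : ℕ, ∃ w ∈ closedBall v R, IsRatPt (F w) ∧ Q ≤ ht (F w) ∧
        dist x w ≤ C * (ht (F w) : ℝ) ^ (-(ckd k d + ε))} = 0 := by
  obtain ⟨R₁, hR₁, m, hm, hporous⟩ := exists_zero_free_subcube hF hspan
  refine ⟨min R₁ 1, by positivity, fun R hR hRR C hC ε hε => ?_⟩
  have hRR₁ : R ≤ R₁ := hRR.trans (min_le_left _ _)
  have hR1 : R ≤ 1 := hRR.trans (min_le_right _ _)
  obtain ⟨κ, hκ, hplane⟩ := exists_hyperplane_of_small_ball hk hF v R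
  have hm0 : 0 < m := one_pos.trans hm
  have hm' : (1 : ℝ) < m := by exact_mod_cast hm
  have hN : 0 < Nkd k d := Nkd_pos hd
  have hN' : (0 : ℝ) < Nkd k d := by exact_mod_cast hN
  set c := ckd k d with hc
  have hcN : c * Nkd k d = (d + 1 : ℕ) := by
    rw [hc, ckd]; push_cast; field_simp
  have hc0 : 0 ≤ c := by rw [hc, ckd]; positivity
  set A : ℝ := (m : ℝ) ^ (1 / ε) with hA
  have hA1 : 1 < A := Real.one_lt_rpow hm' (by positivity)
  have hA0 : 0 < A := one_pos.trans hA1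
  have hAε : A ^ ε = m := by
    rw [hA, ← Real.rpow_mul (by positivity), one_div_mul_cancel hε.ne', Real.rpow_one]
  set κ' : ℝ := κ ^ (1 / (Nkd k d : ℝ)) with hκ'
  have hκ'0 : 0 < κ' := by positivity
  have hκ'N : κ' ^ Nkd k d = κ := by
    rw [hκ', ← Real.rpow_natCast, ← Real.rpow_mul hκ.le, one_div_mul_cancel hN'.ne',
      Real.rpow_one]
  set K : ℝ := C * A ^ c * (R / κ' + 1) / R with hK
  have hK0 : 0 ≤ K := by positivity
  set E : ℕ → Set (Fin k → ℝ) := fun n => {x | ∃ w ∈ closedBall v R, IsRatPt (F w) ∧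
    (ht (F w) : ℝ) ≤ A ^ (n + 1) ∧ dist x w ≤ C * (A ^ n) ^ (-(c + ε))} with hE
  have hEvol : ∀ n, volume (E n) ≤
      ENNReal.ofReal ((2 * (1 + K) * R) ^ k * (1 - 1 / (m : ℝ) ^ k) ^ n) := by
    intro n
    have hT1 : 1 ≤ (A ^ (n + 1)) ^ c := Real.one_le_rpow (one_le_pow₀ hA1.le) hc0
    set t : ℝ := (A ^ (n + 1)) ^ c with ht
    have hp : 0 < ⌈R * t / κ'⌉₊ := Nat.ceil_pos.2 (by positivity)
    have hp' : (0 : ℝ) < ⌈R * t / κ'⌉₊ := by exact_mod_cast hp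
    have hp1 : R * t / κ' ≤ ⌈R * t / κ'⌉₊ := Nat.le_ceil _
    have hp2 : (⌈R * t / κ'⌉₊ : ℝ) ≤ t * (R / κ' + 1) := by
      have := (Nat.ceil_lt_add_one (show 0 ≤ R * t / κ' by positivity)).le
      have e : t * (R / κ' + 1) = R * t / κ' + t := by ring
      linarith
    refine volume_nhd_ratPt_le hR hR1 hplane hm0
      (fun y ρ h1 h2 h3 => hporous y ρ h1 (h2.trans (closedBall_subset_closedBall hRR₁))
        (h3.trans hRR₁)) (by positivity) hp ?_ n hK0 ?_
    · have h1 : t ^ Nkd k d = (A ^ (n + 1)) ^ (d + 1) := by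
        rw [ht, ← Real.rpow_natCast, ← Real.rpow_mul (by positivity), hcN, Real.rpow_natCast]
      rw [← h1, ← mul_pow, ← hκ'N]
      refine pow_le_pow_left₀ (by positivity) ?_ _
      rw [div_le_iff₀ hκ'0] at hp1
      rw [div_mul_eq_mul_div, div_le_iff₀ hp']
      linarith
    · have h1 : (A ^ n) ^ (-(c + ε)) = A ^ c / t / m ^ n := by
        rw [ht, pow_succ, Real.mul_rpow (by positivity) hA0.le, neg_add,
          Real.rpow_add (by positivity), Real.rpow_neg (by positivity),
          Real.rpow_neg (by positivity), ← hAε, ← Real.rpow_natCast, ← Real.rpow_natCast,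
          ← Real.rpow_mul hA0.le, ← Real.rpow_mul hA0.le, ← Real.rpow_mul hA0.le, mul_comm ε]
        field_simp
      rw [h1, hK]
      have h2 : C * (A ^ c / t / m ^ n) = C * A ^ c / t / m ^ n := by ring
      rw [h2]
      gcongr
      rw [div_mul_div_comm, mul_comm R, mul_div_mul_right _ _ hR.ne',
        div_le_div_iff₀ (by positivity) hp']
      calc C * A ^ c * ⌈R * t / κ'⌉₊ ≤ C * A ^ c * (t * (R / κ' + 1)) := by gcongr
        _ = _ := by ring
  have hmk : 1 < (m : ℝ) ^ k := one_lt_pow₀ hm' hk.ne'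
  have hθ : 1 / (m : ℝ) ^ k < 1 := by rw [div_lt_one (by positivity)]; exact hmk
  have hθ0 : 0 < 1 / (m : ℝ) ^ k := by positivity
  have hsum : ∑' n, volume (E n) ≠ ⊤ := by
    refine ne_top_of_le_ne_top ?_ (ENNReal.tsum_le_tsum hEvol)
    have hs : Summable fun n : ℕ => (2 * (1 + K) * R) ^ k * (1 - 1 / (m : ℝ) ^ k) ^ n :=
      (summable_geometric_of_lt_one (by linarith) (by linarith)).mul_left _
    exact hs.tsum_ofReal_ne_top
  refine measure_mono_null ?_ (measure_limsup_atTop_eq_zero hsum)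
  intro x hx
  rw [mem_limsup_iff_frequently_mem, frequently_atTop]
  intro n₀
  obtain ⟨Q, hQ⟩ := exists_nat_ge (A ^ n₀)
  obtain ⟨w, hw, hrat, hQw, hdist⟩ := hx Q
  have hq : A ^ n₀ ≤ (ht (F w) : ℝ) := hQ.trans (by exact_mod_cast hQw)
  obtain ⟨n, hn1, hn2⟩ := exists_nat_pow_near ((one_le_pow₀ hA1.le).trans hq) hA1
  refine ⟨n, ?_, w, hw, hrat, hn2.le, hdist.trans ?_⟩
  · have := (pow_lt_pow_iff_right₀ hA1).1 (hq.trans_lt hn2)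
    exact Nat.lt_succ_iff.1 this
  · gcongr C * ?_
    exact Real.rpow_le_rpow_of_nonpos (by positivity) hn1 (by linarith)

end MeasureEstimate

section Extension

variable {k d : ℕ}

theorem exists_contDiff_eqOn_ball {E G : Type*} [NormedAddCommGroup E] [NormedSpace ℝ E]
    [HasContDiffBump E] [FiniteDimensional ℝ E] [NormedAddCommGroup G] [NormedSpace ℝ G]
    {f : E → G} {U : Set E}
    (hU : IsOpen U) (hf : ContDiffOn ℝ (⊤ : ℕ∞) f U) {v : E} (hv : v ∈ U) :
    ∃ F : E → G, ContDiff ℝ (⊤ : ℕ∞) F ∧ ∃ r > 0, ball v r ⊆ U ∧ EqOn F f (ball v r) := by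
  obtain ⟨R, hR, hRU⟩ := Metric.nhds_basis_closedBall.mem_iff.1 (hU.mem_nhds hv)
  let b : ContDiffBump v := ⟨R / 2, R, by positivity, by linarith⟩
  refine ⟨fun x => b x • f x, contDiff_iff_contDiffAt.2 fun x => ?_, R / 2, by positivity,
    fun x hx => hRU (closedBall_subset_closedBall (by linarith) (ball_subset_closedBall hx)),
    fun x hx => ?_⟩
  · by_cases hx : x ∈ U
    · exact b.contDiff.contDiffAt.smul (hf.contDiffAt (hU.mem_nhds hx))
    · have h1 : x ∉ tsupport b := by
        rw [b.tsupport_eq]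
        exact fun h => hx (hRU h)
      have h2 : (fun x => b x • f x) =ᶠ[nhds x] fun _ => 0 := by
        filter_upwards [notMem_tsupport_iff_eventuallyEq.1 h1] with y hy
        simp [hy]
      exact contDiffAt_const.congr_of_eventuallyEq h2
  · simp [b.one_of_mem_closedBall (ball_subset_closedBall hx)]

theorem HasStrictFDerivAt.eventually_norm_sub_le {E G : Type*} [NormedAddCommGroup E]
    [NormedSpace ℝ E] [FiniteDimensional ℝ E] [NormedAddCommGroup G] [NormedSpace ℝ G]
    {f : E → G} {f' : E →L[ℝ] G} {v : E} (hf : HasStrictFDerivAt f f' v)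
    (hinj : Function.Injective f') :
    ∃ C > (0 : ℝ), ∀ᶠ p : E × E in nhds (v, v), ‖p.1 - p.2‖ ≤ C * ‖f p.1 - f p.2‖ := by
  obtain ⟨K, hK, hL⟩ := (f' : E →ₗ[ℝ] G).exists_antilipschitzWith (LinearMap.ker_eq_bot.2 hinj)
  have hK' : (0 : ℝ) < K := hK
  refine ⟨2 * K, by positivity, ?_⟩
  filter_upwards [hf.isLittleO.def (show 0 < 1 / (2 * (K : ℝ)) by positivity)] with p hp
  have h1 : ‖p.1 - p.2‖ ≤ K * ‖f' (p.1 - p.2)‖ := by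
    have := hL.le_mul_dist (p.1 - p.2) 0
    rwa [map_zero, dist_zero_right, dist_zero_right] at this
  have h2 : ‖f' (p.1 - p.2)‖ ≤ ‖f p.1 - f p.2‖ + 1 / (2 * K) * ‖p.1 - p.2‖ := by
    have := norm_sub_norm_le (f' (p.1 - p.2)) (f p.1 - f p.2)
    rw [norm_sub_rev (f' (p.1 - p.2)) (f p.1 - f p.2)] at this
    linarith
  have h3 : K * ‖f' (p.1 - p.2)‖ ≤ K * ‖f p.1 - f p.2‖ + 1 / 2 * ‖p.1 - p.2‖ := by
    calc _ ≤ K * (‖f p.1 - f p.2‖ + 1 / (2 * K) * ‖p.1 - p.2‖) := by gcongr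
      _ = _ := by field_simp
  linarith

theorem exists_ratPt_near_of_mem_VWAset {M : Set (Fin d → ℝ)} {c ε : ℝ} (hc : 0 < c + ε)
    {y : Fin d → ℝ}
    (hy : {r : Fin d → ℝ | IsRatPt r ∧ r ∈ M ∧ ‖y - r‖ ≤ (ht r : ℝ) ^ (-(c + ε))}.Infinite)
    {η : ℝ} (hη : 0 < η) (Q : ℕ) :
    ∃ r ∈ M, IsRatPt r ∧ Q ≤ ht r ∧ ‖y - r‖ ≤ (ht r : ℝ) ^ (-(c + ε)) ∧ ‖y - r‖ < η := by
  have h1 : ∀ᶠ n : ℕ in atTop, ((n : ℝ)) ^ (-(c + ε)) < η :=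
    ((tendsto_rpow_neg_atTop hc).comp tendsto_natCast_atTop_atTop).eventually_lt_const hη
  obtain ⟨T, hT, hTQ⟩ := (h1.and (eventually_ge_atTop (max Q 1))).exists
  obtain ⟨r, ⟨hr, hrM, hle⟩, hrT⟩ := hy.exists_notMem_finite (finite_ratPt_ht_le y T)
  have hht : (1 : ℝ) ≤ ht r := by exact_mod_cast (ht_spec hr).1
  have hle1 : ‖y - r‖ ≤ 1 := hle.trans (Real.rpow_le_one_of_one_le_of_nonpos hht (by linarith))
  have hTr : T < ht r := by
    by_contra! h
    exact hrT ⟨hr, h, hle1⟩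
  have hT0 : (0 : ℝ) < T := by exact_mod_cast lt_of_lt_of_le one_pos ((le_max_right _ _).trans hTQ)
  refine ⟨r, hrM, hr, (le_max_left _ _).trans (hTQ.trans hTr.le), hle,
    hle.trans_lt (hT.trans_le' ?_)⟩
  exact Real.rpow_le_rpow_of_nonpos hT0 (by exact_mod_cast hTr.le) (by linarith)

theorem exists_nhds_hausdorffMeasure_VWAset_eq_zero (hk : 0 < k) (hd : 0 < d)
    {M : Set (Fin d → ℝ)} {x : Fin d → ℝ} (hx : IsNondeg k d M x) :
    ∃ O : Set (Fin d → ℝ), IsOpen O ∧ x ∈ O ∧ μH[(k : ℝ)] (VWAset M (ckd k d) ∩ O) = 0 := by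
  obtain ⟨D, U, Φ, v, hΦ, hvU, rfl, hspan⟩ := hx
  obtain ⟨F, hF, r, hr, hrU, hFΦ⟩ := exists_contDiff_eqOn_ball hΦ.open_dom hΦ.smooth hvU
  have hFev : F =ᶠ[nhds v] Φ := hFΦ.eventuallyEq_of_mem (ball_mem_nhds v hr)
  have hspanF : Submodule.span ℝ {y : Fin d → ℝ | ∃ α : Fin k → ℕ,
      0 < (∑ j, α j) ∧ (∑ j, α j) ≤ D ∧ y = mderiv α F v} = ⊤ := by
    simpa only [mderiv_congr isOpen_ball hFΦ _ (mem_ball_self hr)] using hspan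
  obtain ⟨R₀, hR₀, hvol⟩ := exists_radius_volume_eq_zero hk hd hF hspanF
  have hstrict : HasStrictFDerivAt F (fderiv ℝ F v) v :=
    hF.contDiffAt.hasStrictFDerivAt (by simp)
  obtain ⟨C, hC, hanti⟩ := hstrict.eventually_norm_sub_le
    (by rw [hFev.fderiv_eq]; exact hΦ.immersion v hvU)
  obtain ⟨K, s, hs, hlip⟩ := hstrict.exists_lipschitzOnWith
  rw [nhds_prod_eq] at hanti
  obtain ⟨s', hs', hanti⟩ := (eventually_prod_self_iff
    (r := fun p q => ‖p - q‖ ≤ C * ‖F p - F q‖)).1 hanti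
  obtain ⟨R₁, hR₁, hR₁s⟩ := Metric.nhds_basis_ball.mem_iff.1 (inter_mem hs hs')
  set R := min R₀ (min R₁ r) with hR
  have hRpos : 0 < R := by positivity
  have hBr : ball v R ⊆ ball v r := ball_subset_ball ((min_le_right _ _).trans (min_le_right _ _))
  have hBs : ball v R ⊆ s ∩ s' :=
    (ball_subset_ball ((min_le_right _ _).trans (min_le_left _ _))).trans hR₁s
  obtain ⟨O, hO, hOM⟩ := hΦ.open_map (ball v R) isOpen_ball
  have hBU : ball v R ∩ U = ball v R := inter_eq_left.2 (hBr.trans hrU)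
  rw [hBU] at hOM
  refine ⟨O, hO, (hOM.subset ⟨v, mem_ball_self hRpos, rfl⟩).1, ?_⟩
  set Z : ℕ → Set (Fin k → ℝ) := fun q => {x | ∀ Q : ℕ, ∃ w ∈ closedBall v R, IsRatPt (F w) ∧
    Q ≤ ht (F w) ∧ dist x w ≤ C * (ht (F w) : ℝ) ^ (-(ckd k d + 1 / ((q : ℝ) + 1)))} with hZ
  have hZ0 : volume (⋃ q, Z q) = 0 := measure_iUnion_null fun q =>
    hvol R hRpos (min_le_left _ _) C hC _ Nat.one_div_pos_of_nat
  have hincl : VWAset M (ckd k d) ∩ O ⊆ F '' (ball v R ∩ ⋃ q, Z q) := by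
    rintro y ⟨⟨hyM, ε, hε, hinf⟩, hyO⟩
    obtain ⟨u, hu, rfl⟩ := hOM.symm.subset ⟨hyO, hyM⟩
    refine ⟨u, ⟨hu, ?_⟩, hFΦ (hBr hu)⟩
    obtain ⟨q, hq⟩ := exists_nat_one_div_lt hε
    refine mem_iUnion.2 ⟨q, fun Q => ?_⟩
    obtain ⟨η, hη, hηO⟩ := Metric.isOpen_iff.1 hO _ hyO
    have hc : 0 ≤ ckd k d := by rw [ckd]; positivity
    obtain ⟨z, hzM, hz, hQz, hle, hlt⟩ :=
      exists_ratPt_near_of_mem_VWAset (by linarith) hinf hη Q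
    have hzO : z ∈ O := hηO (by rwa [mem_ball, dist_comm, dist_eq_norm])
    obtain ⟨w, hw, rfl⟩ := hOM.symm.subset ⟨hzO, hzM⟩
    have hFw : F w = Φ w := hFΦ (hBr hw)
    have hht : (1 : ℝ) ≤ ht (Φ w) := by exact_mod_cast (ht_spec hz).1
    refine ⟨w, ball_subset_closedBall hw, by rwa [hFw], by rwa [hFw], ?_⟩
    have h1 : ‖u - w‖ ≤ C * ‖F u - F w‖ := hanti u (hBs hu).2 w (hBs hw).2
    rw [hFΦ (hBr hu), hFw] at h1
    rw [hFw, dist_eq_norm]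
    refine h1.trans ?_
    gcongr
    refine hle.trans (Real.rpow_le_rpow_of_exponent_le hht ?_)
    linarith
  have hH : μH[(k : ℝ)] (ball v R ∩ ⋃ q, Z q) = 0 := by
    have := @hausdorffMeasure_pi_real (Fin k) _
    rw [Fintype.card_fin] at this
    rw [this]
    exact measure_mono_null inter_subset_right hZ0
  have hlipB : LipschitzOnWith K F (ball v R ∩ ⋃ q, Z q) :=
    hlip.mono (inter_subset_left.trans (hBs.trans inter_subset_left))
  refine measure_mono_null hincl (le_antisymm ?_ zero_le)
  refine (hlipB.hausdorffMeasure_image_le (Nat.cast_nonneg k)).trans ?_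
  rw [hH, mul_zero]

end Extension

/-- **Theorem (very well intrinsically approximable points form a null set).**
If `M ⊆ ℝ^d` is a `C^∞` submanifold of dimension `k` (`1 ≤ k ≤ d`) and `λ_M`-almost
every point of `M` is nondegenerate, where `λ_M` is the `k`-dimensional Hausdorff
measure restricted to `M`, then `λ_M(VWA_M(ψ_{c(k,d)})) = 0`. -/
theorem vwa_nullset (k d : ℕ) (hk : 1 ≤ k) (hkd : k ≤ d)
    (M : Set (Fin d → ℝ)) (hM : IsSmoothSubmanifold k d M)
    (hae : (μH[(k : ℝ)]).restrict M {x ∈ M | ¬ IsNondeg k d M x} = 0) :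
    (μH[(k : ℝ)]).restrict M (VWAset M (ckd k d)) = 0 := by
  have hVM : VWAset M (ckd k d) ⊆ M := fun x hx => hx.1
  rw [Measure.restrict_eq_self _ (sep_subset _ _)] at hae
  rw [Measure.restrict_eq_self _ hVM]
  have hgood : μH[(k : ℝ)] {x ∈ VWAset M (ckd k d) | IsNondeg k d M x} = 0 := by
    refine measure_null_of_locally_null _ fun x hx => ?_
    obtain ⟨O, hO, hxO, hzero⟩ :=
      exists_nhds_hausdorffMeasure_VWAset_eq_zero hk (hk.trans hkd) hx.2
    refine ⟨_, inter_mem_nhdsWithin _ (hO.mem_nhds hxO), measure_mono_null ?_ hzero⟩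
    exact inter_subset_inter_left _ (sep_subset _ _)
  refine measure_mono_null (fun x hx => ?_) (measure_union_null hae hgood)
  by_cases h : IsNondeg k d M x
  · exact Or.inr ⟨hx, h⟩
  · exact Or.inl ⟨hVM hx, h⟩
end
end

section
/- (Simplex lemma for intrinsic approximation on manifolds.) Let 1 ≤ k ≤ d be integers, let M ⊆ ℝ^d be a C^∞ submanifold of dimension k, let Ψ: U → M be a C^∞ local parameterization with U ⊆ ℝ^k open, and let V ⊆ U be compact. Then there exists κ > 0 such that for all s ∈ U and all 0 < ρ ≤ 1, the set S_{s,ρ} of all rational points r = p/q ∈ ℚ^d lying in Ψ(V ∩ B(s,ρ)) and having height H(r) = q ≤ κ·ρ^{−N_{k,d}/(d+1)} is contained in a single affine hyperplane of ℝ^d. -/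
open Set Filter Metric MeasureTheory
noncomputable section

theorem exists_contDiff_hasCompactSupport_eqOn {E F : Type*} [NormedAddCommGroup E]
    [NormedSpace ℝ E] [FiniteDimensional ℝ E] [NormedAddCommGroup F] [NormedSpace ℝ F]
    {U V : Set E} {f : E → F} (hU : IsOpen U) (hf : ContDiffOn ℝ (⊤ : ℕ∞) f U)
    (hV : IsCompact V) (hVU : V ⊆ U) :
    ∃ g : E → F, ContDiff ℝ (⊤ : ℕ∞) g ∧ HasCompactSupport g ∧ EqOn g f V := by
  obtain ⟨K, hK, hVK, hKU⟩ := exists_compact_between hV hU hVU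
  obtain ⟨χ, hχ1, hχ0, -⟩ := exists_contMDiffMap_one_nhds_of_subset_interior
    (n := ⊤) (modelWithCornersSelf ℝ E) hV.isClosed hVK
  have hχ : ContDiff ℝ (⊤ : ℕ∞) χ := χ.contMDiff.contDiff
  refine ⟨fun x => χ x • f x, contDiff_iff_contDiffAt.2 fun x => ?_,
    HasCompactSupport.intro hK fun x hx => by simp [hχ0 x hx], fun x hx => ?_⟩
  · by_cases hx : x ∈ U
    · exact hχ.contDiffAt.smul (hf.contDiffAt (hU.mem_nhds hx))
    · have h0 : (fun x => χ x • f x) =ᶠ[nhds x] fun _ => 0 := by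
        filter_upwards [hK.isClosed.isOpen_compl.mem_nhds fun h => hx (hKU h)] with y hy
        simp [hχ0 y hy]
      exact contDiffAt_const.congr_of_eventuallyEq h0
  · simp [hχ1.self_of_nhdsSet x hx]

/-- Uniform multivariate Taylor expansion, organised by monomials. -/
theorem exists_taylor_sym_bound {k : ℕ} {F : Type*} [NormedAddCommGroup F] [NormedSpace ℝ F]
    [CompleteSpace F] {f : (Fin k → ℝ) → F} (hf : ContDiff ℝ (⊤ : ℕ∞) f)
    (hc : HasCompactSupport f) (n : ℕ) :
    ∃ (B : ℝ) (c : (Fin k → ℝ) → (Σ j : Fin (n + 1), Sym (Fin k) j) → F), 0 ≤ B ∧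
      (∀ x α, ‖c x α‖ ≤ B) ∧
      ∀ x h, ‖f (x + h) - ∑ α, ((α.2 : Multiset (Fin k)).map h).prod • c x α‖ ≤
        B * ‖h‖ ^ (n + 1) := by
  have hD : ∀ j : ℕ, ∃ C, 0 ≤ C ∧ ∀ x, ‖iteratedFDeriv ℝ j f x‖ ≤ C := fun j => by
    obtain ⟨C, hC⟩ := (hf.continuous_iteratedFDeriv (m := j)
      (by exact_mod_cast le_top)).bounded_above_of_compact_support (hc.iteratedFDeriv j)
    exact ⟨C, (norm_nonneg _).trans (hC 0), hC⟩
  choose C hC0 hC using hD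
  let S : ∀ {j : ℕ}, (Fin j → Fin k) → Sym (Fin k) j := fun {j} φ =>
    ⟨Finset.univ.val.map φ, by simp⟩
  let c : (Fin k → ℝ) → (Σ j : Fin (n + 1), Sym (Fin k) j) → F := fun x α =>
    ((α.1 : ℕ).factorial : ℝ)⁻¹ • ∑ φ : Fin α.1 → Fin k with S φ = α.2,
      iteratedFDeriv ℝ α.1 f x fun l => Pi.single (φ l) 1
  have hcb : ∀ α, ∃ b, 0 ≤ b ∧ ∀ x, ‖c x α‖ ≤ b := fun α => by
    refine ⟨‖((α.1 : ℕ).factorial : ℝ)⁻¹‖ * ∑ φ : Fin α.1 → Fin k with S φ = α.2, C α.1,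
      mul_nonneg (norm_nonneg _) (Finset.sum_nonneg fun _ _ => hC0 _), fun x => ?_⟩
    rw [norm_smul]
    gcongr
    refine norm_sum_le_of_le _ fun φ _ => ?_
    refine ((iteratedFDeriv ℝ α.1 f x).le_opNorm _).trans ?_
    simpa [Pi.norm_single] using hC α.1 x
  choose b hb0 hb using hcb
  refine ⟨C (n + 1) + ∑ α, b α, c, add_nonneg (hC0 _) (Finset.sum_nonneg fun α _ => hb0 α),
    fun x α => (hb α x).trans ?_, fun x h => ?_⟩
  · have := Finset.single_le_sum (fun α _ => hb0 α) (Finset.mem_univ α)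
    linarith [hC0 (n + 1)]
  · have hexp : ∀ j : ℕ, iteratedFDeriv ℝ j f x (fun _ => h) = ∑ σ : Sym (Fin k) j,
        ((σ : Multiset (Fin k)).map h).prod • ∑ φ : Fin j → Fin k with S φ = σ,
          iteratedFDeriv ℝ j f x fun l => Pi.single (φ l) 1 := fun j => by
      have hh : h = ∑ a, h a • (Pi.single a 1 : Fin k → ℝ) := by
        ext i; simp [Finset.sum_apply, Pi.single_apply]
      conv_lhs => rw [hh]
      rw [ContinuousMultilinearMap.map_sum, ← Finset.sum_fiberwise _ S]
      refine Finset.sum_congr rfl fun σ _ => ?_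
      rw [Finset.smul_sum]
      refine Finset.sum_congr rfl fun φ hφ => ?_
      rw [ContinuousMultilinearMap.map_smul_univ, ← (Finset.mem_filter.1 hφ).2]
      simp [S, Function.comp_def, List.prod_ofFn]
    have hsum : ∑ j ∈ Finset.range (n + 1),
        ((j.factorial : ℝ)⁻¹ • iteratedFDeriv ℝ j f x fun _ => h) =
        ∑ α : (Σ j : Fin (n + 1), Sym (Fin k) j),
          ((α.2 : Multiset (Fin k)).map h).prod • c x α := by
      rw [Fintype.sum_sigma, Finset.sum_range]
      refine Finset.sum_congr rfl fun j _ => ?_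
      rw [hexp, Finset.smul_sum]
      exact Finset.sum_congr rfl fun σ _ => smul_comm _ _ _
    rw [map_add_eq_sum_add_integral_iteratedFDeriv (n := n) fun t _ =>
      (hf.of_le (by exact_mod_cast le_top)).contDiffAt, hsum, add_sub_cancel_left, norm_smul]
    have hint : ‖∫ t in (0 : ℝ)..1, (1 - t) ^ n • iteratedFDeriv ℝ (n + 1) f (x + t • h)
        fun _ => h‖ ≤ C (n + 1) * ‖h‖ ^ (n + 1) * |(1 : ℝ) - 0| := by
      refine intervalIntegral.norm_integral_le_of_norm_le_const fun t ht => ?_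
      rw [uIoc_of_le zero_le_one] at ht
      rw [norm_smul]
      have h1 : ‖(1 - t) ^ n‖ ≤ 1 := by
        rw [norm_pow, Real.norm_of_nonneg (by linarith [ht.2])]
        exact pow_le_one₀ (by linarith [ht.2]) (by linarith [ht.1])
      have h2 : ‖iteratedFDeriv ℝ (n + 1) f (x + t • h) fun _ => h‖ ≤
          C (n + 1) * ‖h‖ ^ (n + 1) := by
        refine ((iteratedFDeriv ℝ (n + 1) f (x + t • h)).le_opNorm _).trans ?_
        simpa using mul_le_mul_of_nonneg_right (hC (n + 1) (x + t • h)) (by positivity)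
      calc _ ≤ 1 * (C (n + 1) * ‖h‖ ^ (n + 1)) := by gcongr
        _ = _ := one_mul _
    have hfac : ‖(n.factorial : ℝ)⁻¹‖ ≤ 1 := by
      rw [norm_inv, Real.norm_natCast]
      exact inv_le_one_of_one_le₀ (by exact_mod_cast n.factorial_pos)
    calc _ ≤ 1 * (C (n + 1) * ‖h‖ ^ (n + 1) * |(1 : ℝ) - 0|) := by gcongr
      _ = C (n + 1) * ‖h‖ ^ (n + 1) := by simp
      _ ≤ _ := by
        gcongr
        exact le_add_of_nonneg_right (Finset.sum_nonneg fun α _ => hb0 α)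

theorem le_sum_elim_of_injective_on_some {ι : Type*} [Fintype ι] {m W N : ℕ} {w : ι → ℕ}
    (hw : ∀ α, w α ≤ W) (hN : N + ∑ α, (W - w α) ≤ m * W) (f : Fin m → Option ι)
    (hf : ∀ i i' α, f i = some α → f i' = some α → i = i') :
    N ≤ ∑ i, (f i).elim W w := by
  classical
  have h1 : ∑ i, (W - (f i).elim W w) ≤ ∑ α, (W - w α) := by
    rw [← Finset.sum_fiberwise _ f, Fintype.sum_option]
    have h0 : ∑ i with f i = none, (W - (f i).elim W w) = 0 :=
      Finset.sum_eq_zero fun i hi => by simp [(Finset.mem_filter.1 hi).2]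
    rw [h0, zero_add]
    refine Finset.sum_le_sum fun α _ => ?_
    calc ∑ i with f i = some α, (W - (f i).elim W w)
        = ∑ i with f i = some α, (W - w α) :=
          Finset.sum_congr rfl fun i hi => by simp [(Finset.mem_filter.1 hi).2]
      _ ≤ 1 * (W - w α) := by
          rw [Finset.sum_const, smul_eq_mul]
          gcongr
          exact Finset.card_le_one.2 fun i hi i' hi' =>
            hf i i' α (Finset.mem_filter.1 hi).2 (Finset.mem_filter.1 hi').2
      _ = _ := one_mul _
  have h2 : ∑ i, (W - (f i).elim W w) + ∑ i, (f i).elim W w = m * W := by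
    rw [← Finset.sum_add_distrib]
    calc _ = ∑ _i : Fin m, W := Finset.sum_congr rfl fun i _ => by
          rcases f i with _ | α
          · simp
          · simpa using Nat.sub_add_cancel (hw α)
      _ = _ := by simp
  omega

/-- If the rows of a matrix are combinations of fixed vectors `c α`, with coefficients of size
`ρ ^ w α`, up to errors of size `ρ ^ W`, then its determinant is of size `ρ ^ N`, where `N` is
the least total weight of a choice of distinct vectors and errors for the rows. -/
theorem abs_det_le_of_approx {ι : Type*} [Fintype ι] {m W N : ℕ} {w : ι → ℕ}
    (hw : ∀ α, w α ≤ W) (hN : N + ∑ α, (W - w α) ≤ m * W) {B ρ : ℝ} (hB : 0 ≤ B)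
    (hρ : 0 < ρ) (hρ1 : ρ ≤ 1) (A : Matrix (Fin m) (Fin m) ℝ) (c : ι → Fin m → ℝ)
    (a : Fin m → ι → ℝ) (hc : ∀ α, ‖c α‖ ≤ B) (ha : ∀ i α, |a i α| ≤ ρ ^ w α)
    (hA : ∀ i, ‖A i - ∑ α, a i α • c α‖ ≤ B * ρ ^ W) :
    |A.det| ≤ Fintype.card (Fin m → Option ι) * (m.factorial * B ^ m) * ρ ^ N := by
  classical
  let a' : Fin m → Option ι → ℝ := fun i x => x.elim (ρ ^ W) (a i)
  let z : Fin m → Option ι → Fin m → ℝ := fun i x =>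
    x.elim ((ρ ^ W)⁻¹ • (A i - ∑ α, a i α • c α)) c
  have hρW : 0 < ρ ^ W := pow_pos hρ W
  have hrow : A = fun i => ∑ x, a' i x • z i x := by
    funext i
    rw [Fintype.sum_option]
    simp [a', z, smul_smul, mul_inv_cancel₀ hρW.ne']
  have ha' : ∀ i x, |a' i x| ≤ ρ ^ (x.elim W w) := by
    rintro i (_ | α)
    · simp [a', abs_of_pos hρ]
    · exact ha i α
  have hz : ∀ i x, ‖z i x‖ ≤ B := by
    rintro i (_ | α)
    · simp only [z, Option.elim_none, norm_smul, norm_inv, Real.norm_of_nonneg hρW.le]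
      rw [inv_mul_le_iff₀ hρW, mul_comm]
      exact hA i
    · exact hc α
  have hdet : A.det = ∑ f : Fin m → Option ι,
      (∏ i, a' i (f i)) * Matrix.det fun i => z i (f i) := by
    have h := (Matrix.detRowAlternating (n := Fin m) (R := ℝ)).toMultilinearMap.map_sum
      fun i x => a' i x • z i x
    rw [hrow]
    refine h.trans (Finset.sum_congr rfl fun f _ => ?_)
    exact MultilinearMap.map_smul_univ _ _ _
  rw [hdet]
  refine (Finset.abs_sum_le_sum_abs _ _).trans ?_
  refine (Finset.sum_le_card_nsmul _ _ ((m.factorial * B ^ m) * ρ ^ N) fun f _ => ?_).trans_eq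
    (by rw [nsmul_eq_mul, Finset.card_univ, ← mul_assoc])
  by_cases hf : ∀ i i' α, f i = some α → f i' = some α → i = i'
  · have hd : |Matrix.det fun i => z i (f i)| ≤ m.factorial * B ^ m := by
      have := Matrix.det_le (A := fun i => z i (f i)) (abv := AbsoluteValue.abs) (x := B)
        fun i j => (norm_le_pi_norm (z i (f i)) j).trans (hz i (f i))
      simpa using this
    have hp : |∏ i, a' i (f i)| ≤ ρ ^ N := by
      rw [Finset.abs_prod]
      calc _ ≤ ∏ i, ρ ^ ((f i).elim W w) :=
            Finset.prod_le_prod (fun _ _ => abs_nonneg _) fun i _ => ha' i (f i)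
        _ = ρ ^ ∑ i, (f i).elim W w := Finset.prod_pow_eq_pow_sum _ _ _
        _ ≤ ρ ^ N := pow_le_pow_of_le_one hρ.le hρ1 (le_sum_elim_of_injective_on_some hw hN f hf)
    rw [abs_mul, mul_comm]
    gcongr
  · push Not at hf
    obtain ⟨i, i', α, hi, hi', hne⟩ := hf
    have h0 : (Matrix.det fun i => z i (f i)) = 0 :=
      Matrix.det_zero_of_row_eq hne (by simp [hi, hi', z])
    rw [h0, mul_zero, abs_zero]
    positivity

theorem exists_dotProduct_eq_zero_of_det_eq_zero {K : Type*} [Field K] {m : ℕ}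
    (S : Set (Fin m → K))
    (hS : ∀ v : Fin m → Fin m → K, (∀ i, v i ∈ S) → Matrix.det (Matrix.of v) = 0) :
    ∃ φ : Fin m → K, φ ≠ 0 ∧ ∀ x ∈ S, ∑ i, φ i * x i = 0 := by
  have htop : Submodule.span K S < ⊤ := by
    rw [lt_top_iff_ne_top]
    intro htop
    obtain ⟨t, htS, hspan, hli⟩ := exists_linearIndependent K S
    let b := Module.Basis.mk hli (by rw [Subtype.range_coe, hspan, htop])
    have := Module.Finite.finite_basis b
    have := Fintype.ofFinite t
    have hcard : Fintype.card t = Fintype.card (Fin m) := by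
      rw [← Module.finrank_eq_card_basis b]; simp
    let e := (Fintype.equivOfCardEq hcard).symm
    have hdet := hS (fun i => (e i : Fin m → K)) fun i => htS (e i).2
    have hli' : LinearIndependent K (Matrix.of fun i => (e i : Fin m → K)).row :=
      hli.comp e e.injective
    rw [Matrix.linearIndependent_rows_iff_isUnit, Matrix.isUnit_iff_isUnit_det, hdet] at hli'
    exact not_isUnit_zero hli'
  obtain ⟨g, hg0, hg⟩ := Submodule.exists_le_ker_of_lt_top _ htop
  have hgx : ∀ x, g x = ∑ i, g (Pi.single i 1) * x i := fun x => by
    rw [LinearMap.pi_apply_eq_sum_univ g x]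
    refine Finset.sum_congr rfl fun i _ => ?_
    rw [smul_eq_mul, mul_comm]
    congr 2
    ext j
    simp [Pi.single_apply, eq_comm]
  refine ⟨fun i => g (Pi.single i 1), fun h => hg0 ?_, fun x hx => ?_⟩
  · ext x
    simpa using congr_fun h x
  · rw [← hgx]
    exact hg (Submodule.subset_span hx)

theorem Nkd_add_sum_sym {k : ℕ} (hk : 1 ≤ k) (d : ℕ) :
    Nkd k d + ∑ α : (Σ j : Fin (nkd k d + 1), Sym (Fin k) j), (nkd k d + 1 - α.1) =
      (d + 1) * (nkd k d + 1) := by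
  have hS := Ssum_nkd_le k d
  set n := nkd k d with hn
  have hsum : ∑ α : (Σ j : Fin (n + 1), Sym (Fin k) j), (n + 1 - (α.1 : ℕ)) =
      (n + 1) + ∑ j ∈ Finset.Icc 1 n, (n + 1 - j) * Nat.choose (k - 1 + j) j := by
    rw [Fintype.sum_sigma]
    have hterm : ∀ j : Fin (n + 1), ∑ _σ : Sym (Fin k) j, (n + 1 - (j : ℕ)) =
        (n + 1 - (j : ℕ)) * Nat.choose (k - 1 + j) j := fun j => by
      rw [Finset.sum_const, Finset.card_univ, Sym.card_sym_eq_choose, Fintype.card_fin,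
        smul_eq_mul, mul_comm, Nat.sub_add_comm hk]
    simp only [hterm]
    rw [← Finset.sum_range fun j => (n + 1 - j) * Nat.choose (k - 1 + j) j, Finset.range_eq_Ico,
      Finset.sum_eq_sum_Ico_succ_bot (Nat.succ_pos n)]
    simp [← Finset.Ico_add_one_right_eq_Icc]
  have hcomb : (∑ j ∈ Finset.Icc 1 n, j * Nat.choose (k - 1 + j) j) +
      ∑ j ∈ Finset.Icc 1 n, (n + 1 - j) * Nat.choose (k - 1 + j) j = (n + 1) * Ssum k n := by
    rw [Ssum, Finset.mul_sum, ← Finset.sum_add_distrib]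
    refine Finset.sum_congr rfl fun j hj => ?_
    rw [← add_mul, Nat.add_sub_cancel' (by have := (Finset.mem_Icc.1 hj).2; omega)]
  have hm : (n + 1) * Ssum k n + (n + 1) * mkd k d = (n + 1) * d := by
    rw [← mul_add, mkd, ← hn, Nat.add_sub_cancel' hS]
  rw [hsum, Nkd, ← hn]
  linarith

theorem exists_abs_det_le_mul_pow {k d : ℕ} (hk : 1 ≤ k) {f : (Fin k → ℝ) → Fin (d + 1) → ℝ}
    (hf : ContDiff ℝ (⊤ : ℕ∞) f) (hc : HasCompactSupport f) :
    ∃ C : ℝ, 0 ≤ C ∧ ∀ (s : Fin k → ℝ) (ρ : ℝ), 0 < ρ → ρ ≤ 1 → ∀ v : Fin (d + 1) → Fin k → ℝ,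
      (∀ i, v i ∈ closedBall s ρ) →
        |Matrix.det (Matrix.of fun i => f (v i))| ≤ C * ρ ^ Nkd k d := by
  obtain ⟨B, c, hB, hcB, hT⟩ := exists_taylor_sym_bound hf hc (nkd k d)
  refine ⟨_, ?_, fun s ρ hρ hρ1 v hv =>
    abs_det_le_of_approx (W := nkd k d + 1) (w := fun α => (α.1 : ℕ)) (fun α => α.1.2.le)
      (Nkd_add_sum_sym hk d).le hB hρ hρ1 _ (c s)
      (fun i α => ((α.2 : Multiset (Fin k)).map (v i - s)).prod) (hcB s) (fun i α => ?_)
      fun i => ?_⟩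
  · positivity
  · have hcoord : ∀ x, |(v i - s) x| ≤ ρ := fun x =>
      (norm_le_pi_norm (v i - s) x).trans (mem_closedBall_iff_norm.1 (hv i))
    have hmul : ∀ t : Multiset (Fin k), |(t.map (v i - s)).prod| ≤ ρ ^ t.card := fun t => by
      induction t using Multiset.induction with
      | empty => simp
      | cons x t ih =>
        rw [Multiset.map_cons, Multiset.prod_cons, abs_mul, Multiset.card_cons, pow_succ']
        gcongr
        exact hcoord x
    simpa using hmul α.2
  · have h := hT s (v i - s)
    rw [add_sub_cancel] at h
    refine h.trans ?_
    gcongr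
    exact mem_closedBall_iff_norm.1 (hv i)

theorem ht_mem {d : ℕ} {r : Fin d → ℝ} (hr : IsRatPt r) :
    0 < ht r ∧ ∀ i, ∃ m : ℤ, (ht r : ℝ) * r i = m := by
  refine Nat.sInf_mem (s := {q : ℕ | 0 < q ∧ ∀ i, ∃ m : ℤ, (q : ℝ) * r i = (m : ℝ)}) ?_
  choose a ha using hr
  refine ⟨∏ i, (a i).den, Finset.prod_pos fun i _ => (a i).den_pos, fun i => ?_⟩
  obtain ⟨c, hc⟩ := Finset.dvd_prod_of_mem (fun i => (a i).den) (Finset.mem_univ i)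
  refine ⟨(a i).num * c, ?_⟩
  rw [hc, ha]
  have h : ((a i).den : ℝ) * (a i : ℝ) = (a i).num := by exact_mod_cast Rat.den_mul_eq_num (a i)
  push_cast
  rw [mul_right_comm, h]

theorem det_cons_one_eq_zero_of_lt_one {d : ℕ} (r : Fin (d + 1) → Fin d → ℝ)
    (q : Fin (d + 1) → ℕ) (hq0 : ∀ i, 0 < q i) (hq : ∀ i j, ∃ m : ℤ, (q i : ℝ) * r i j = m)
    (hlt : (∏ i, (q i : ℝ)) *
      |Matrix.det (Matrix.of fun i => (Fin.cons 1 (r i) : Fin (d + 1) → ℝ))| < 1) :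
    Matrix.det (Matrix.of fun i => (Fin.cons 1 (r i) : Fin (d + 1) → ℝ)) = 0 := by
  choose p hp using hq
  set A : Matrix (Fin (d + 1)) (Fin (d + 1)) ℝ :=
    Matrix.of fun i => (Fin.cons 1 (r i) : Fin (d + 1) → ℝ)
  let Z : Matrix (Fin (d + 1)) (Fin (d + 1)) ℤ :=
    Matrix.of fun i => (Fin.cons (q i : ℤ) (p i) : Fin (d + 1) → ℤ)
  have hZ : ((Z.det : ℤ) : ℝ) = (∏ i, (q i : ℝ)) * A.det := by
    rw [← Matrix.det_mul_column, Int.cast_det]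
    congr 1
    ext i j
    refine Fin.cases ?_ (fun j => ?_) j <;> simp [Z, A, hp]
  have hprod : (0 : ℝ) < ∏ i, (q i : ℝ) :=
    Finset.prod_pos fun i _ => by exact_mod_cast hq0 i
  have hZ0 : Z.det = 0 := by
    rw [← Int.abs_lt_one_iff]
    have : |((Z.det : ℤ) : ℝ)| < 1 := by rwa [hZ, abs_mul, abs_of_pos hprod]
    exact_mod_cast this
  rw [hZ0, Int.cast_zero] at hZ
  exact (mul_eq_zero.1 hZ.symm).resolve_left hprod.ne'

/-- **Simplex lemma for intrinsic approximation on manifolds.**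
Let `M ⊆ ℝ^d` be a `C^∞` submanifold of dimension `k`, `Ψ : U → M` a local
parameterization, and `V ⊆ U` compact. Then there is `κ > 0` such that for all
`s ∈ U` and `0 < ρ ≤ 1`, the set of rational points of `Ψ(V ∩ B(s,ρ))` of height
at most `κ·ρ^{-N_{k,d}/(d+1)}` lies in a single affine hyperplane of `ℝ^d`. -/
theorem intrinsic_simplex_lemma (k d : ℕ) (hk : 1 ≤ k) (hkd : k ≤ d)
    (M : Set (Fin d → ℝ)) (hM : IsSmoothSubmanifold k d M)
    (U : Set (Fin k → ℝ)) (Ψ : (Fin k → ℝ) → (Fin d → ℝ)) (hΨ : IsLocParam k d M U Ψ)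
    (V : Set (Fin k → ℝ)) (hV : IsCompact V) (hVU : V ⊆ U) :
    ∃ κ > (0 : ℝ), ∀ s ∈ U, ∀ ρ : ℝ, 0 < ρ → ρ ≤ 1 →
      ∃ (w : Fin d → ℝ) (a : ℝ), w ≠ 0 ∧
        ∀ r : Fin d → ℝ, IsRatPt r → r ∈ Ψ '' (V ∩ closedBall s ρ) →
          (ht r : ℝ) ≤ κ * ρ ^ (-(Nkd k d : ℝ) / (d + 1)) →
          (∑ i, w i * r i) = a := by
  have hcons : ContDiffOn ℝ (⊤ : ℕ∞) (fun x => (Fin.cons 1 (Ψ x) : Fin (d + 1) → ℝ)) U := by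
    refine contDiffOn_pi.2 fun j => Fin.cases ?_ (fun j => ?_) j
    · simpa using contDiffOn_const
    · simpa using contDiffOn_pi.1 hΨ.smooth j
  obtain ⟨g, hg, hgc, hgV⟩ := exists_contDiff_hasCompactSupport_eqOn hΨ.open_dom hcons hV hVU
  obtain ⟨C, hC, hdet⟩ := exists_abs_det_le_mul_pow hk hg hgc
  refine ⟨(C + 1)⁻¹, by positivity, fun s _ ρ hρ hρ1 => ?_⟩
  set H : ℝ := (C + 1)⁻¹ * ρ ^ (-(Nkd k d : ℝ) / (d + 1)) with hH
  have hHpow : H ^ (d + 1) * (C * ρ ^ Nkd k d) < 1 := by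
    have hρN : (ρ ^ (-(Nkd k d : ℝ) / (d + 1))) ^ (d + 1) * ρ ^ Nkd k d = 1 := by
      rw [← Real.rpow_natCast, ← Real.rpow_mul hρ.le, ← Real.rpow_natCast, ← Real.rpow_add hρ]
      have hd : (d : ℝ) + 1 ≠ 0 := by positivity
      push_cast
      rw [div_mul_cancel₀ _ hd, neg_add_cancel, Real.rpow_zero]
    calc H ^ (d + 1) * (C * ρ ^ Nkd k d)
        = (C + 1)⁻¹ ^ (d + 1) * C *
            ((ρ ^ (-(Nkd k d : ℝ) / (d + 1))) ^ (d + 1) * ρ ^ Nkd k d) := by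
          rw [hH, mul_pow]; ring
      _ = (C + 1)⁻¹ ^ (d + 1) * C := by rw [hρN, mul_one]
      _ ≤ (C + 1)⁻¹ * C := by
          gcongr
          exact pow_le_of_le_one (by positivity) (inv_le_one_of_one_le₀ (by linarith))
            d.succ_ne_zero
      _ < 1 := by rw [inv_mul_lt_iff₀ (by positivity)]; linarith
  set S : Set (Fin d → ℝ) := {r | IsRatPt r ∧ r ∈ Ψ '' (V ∩ closedBall s ρ) ∧ (ht r : ℝ) ≤ H}
  obtain ⟨φ, hφ0, hφ⟩ := exists_dotProduct_eq_zero_of_det_eq_zero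
    ((fun r => (Fin.cons 1 r : Fin (d + 1) → ℝ)) '' S) fun x hx => by
      choose r hr hrx using hx
      obtain rfl : (fun i => (Fin.cons 1 (r i) : Fin (d + 1) → ℝ)) = x := funext hrx
      refine det_cons_one_eq_zero_of_lt_one r (fun i => ht (r i)) (fun i => (ht_mem (hr i).1).1)
        (fun i => (ht_mem (hr i).1).2) (lt_of_le_of_lt ?_ hHpow)
      choose v hv hvr using fun i => (hr i).2.1
      have hgv : (fun i => (Fin.cons 1 (r i) : Fin (d + 1) → ℝ)) = fun i => g (v i) :=
        funext fun i => by simp only [hgV (hv i).1, hvr]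
      rw [hgv]
      gcongr
      · calc ∏ i, (ht (r i) : ℝ) ≤ ∏ _i : Fin (d + 1), H :=
              Finset.prod_le_prod (fun _ _ => Nat.cast_nonneg _) fun i _ => (hr i).2.2
          _ = H ^ (d + 1) := by simp
      · exact hdet s ρ hρ hρ1 v fun i => (hv i).2
  have hφS : ∀ r ∈ S, φ 0 + ∑ i : Fin d, φ i.succ * r i = 0 := fun r hr => by
    simpa [Fin.sum_univ_succ] using hφ _ ⟨r, hr, rfl⟩
  by_cases hw : (fun i : Fin d => φ i.succ) = 0
  · have hSe : ∀ r, r ∉ S := fun r hr => hφ0 <| by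
      have h0 : φ 0 = 0 := by
        simpa [fun i : Fin d => congr_fun hw i] using hφS r hr
      exact funext fun j => Fin.cases h0 (fun i => congr_fun hw i) j
    exact ⟨Pi.single ⟨0, hk.trans hkd⟩ 1, 0, by simp, fun r h1 h2 h3 =>
      absurd ⟨h1, h2, h3⟩ (hSe r)⟩
  · exact ⟨fun i => φ i.succ, -φ 0, hw, fun r h1 h2 h3 => by
      linarith [hφS r ⟨h1, h2, h3⟩]⟩
end
end

section
/- Let 1 ≤ k ≤ d be integers. If α_1, …, α_{d+1} ∈ ℕ^k are d+1 pairwise distinct multi-indices, then |α_1| + |α_2| + … + |α_{d+1}| ≥ N_{k,d}. Moreover, this bound is sharp: there exist d+1 pairwise distinct multi-indices α_1, …, α_{d+1} ∈ ℕ^k with |α_1| + … + |α_{d+1}| = N_{k,d}. -/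
open Set Filter Metric MeasureTheory
noncomputable section

/-- The number of multi-indices in `ℕ^k` of order `j`. -/
theorem card_piAntidiag_fin {k : ℕ} (hk : 1 ≤ k) (j : ℕ) :
    (Finset.piAntidiag (Finset.univ : Finset (Fin k)) j).card = Nat.choose (k - 1 + j) j := by
  rw [← Finset.map_sym_eq_piAntidiag, Finset.card_map, Finset.sym_univ, Finset.card_univ,
    Sym.card_sym_eq_choose, Fintype.card_fin]
  congr 1
  omega

/-- The multi-indices in `ℕ^k` of order at most `n`. -/
def multiIndexBall (k n : ℕ) : Finset (Fin k → ℕ) :=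
  (Finset.range (n + 1)).biUnion fun j => Finset.piAntidiag Finset.univ j

theorem mem_multiIndexBall {k n : ℕ} {a : Fin k → ℕ} :
    a ∈ multiIndexBall k n ↔ ∑ j, a j ≤ n := by
  simp [multiIndexBall]

theorem sum_multiIndexBall {k : ℕ} (hk : 1 ≤ k) (n : ℕ) (f : ℕ → ℕ) :
    ∑ a ∈ multiIndexBall k n, f (∑ j, a j) =
      f 0 + ∑ j ∈ Finset.Icc 1 n, f j * Nat.choose (k - 1 + j) j := by
  have hsum (j : ℕ) : ∑ a ∈ Finset.piAntidiag (Finset.univ : Finset (Fin k)) j, f (∑ i, a i) =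
      f j * Nat.choose (k - 1 + j) j := by
    rw [← card_piAntidiag_fin hk j, mul_comm, ← smul_eq_mul]
    refine Finset.sum_eq_card_nsmul fun a ha => ?_
    rw [(Finset.mem_piAntidiag.1 ha).1]
  rw [multiIndexBall, Finset.sum_biUnion, Finset.sum_congr rfl fun j _ => hsum j,
    Finset.range_eq_Ico, Finset.sum_eq_sum_Ico_succ_bot (Nat.succ_pos n)]
  · simp only [add_zero, Nat.choose_zero_right, mul_one]
    rfl
  · intro i _ j _ hij
    refine Finset.disjoint_left.2 fun a ha hb => hij ?_
    rw [← (Finset.mem_piAntidiag.1 ha).1, (Finset.mem_piAntidiag.1 hb).1]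

theorem card_multiIndexBall {k : ℕ} (hk : 1 ≤ k) (n : ℕ) :
    (multiIndexBall k n).card = 1 + Ssum k n := by
  simpa [Ssum] using sum_multiIndexBall hk n fun _ => 1

theorem bddAbove_Ssum_le (k d : ℕ) : BddAbove {n : ℕ | Ssum k n ≤ d} :=
  ⟨d, fun n hn => (le_Ssum k n).trans hn⟩

theorem lt_Ssum_nkd_succ (k d : ℕ) : d < Ssum k (nkd k d + 1) := by
  by_contra! h
  exact (Nat.lt_succ_self (nkd k d)).not_ge (le_csSup (bddAbove_Ssum_le k d) h)

theorem mkd_le_choose (k d : ℕ) :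
    mkd k d ≤ Nat.choose (k - 1 + (nkd k d + 1)) (nkd k d + 1) := by
  have h := lt_Ssum_nkd_succ k d
  rw [Ssum, Finset.sum_Icc_succ_top (by omega), ← Ssum] at h
  rw [mkd]
  omega

theorem card_multiIndexBall_add_mkd {k : ℕ} (hk : 1 ≤ k) (d : ℕ) :
    (multiIndexBall k (nkd k d)).card + mkd k d = d + 1 := by
  have h := Ssum_nkd_le k d
  rw [card_multiIndexBall hk, mkd]
  omega

theorem Nkd_eq_sum_multiIndexBall {k : ℕ} (hk : 1 ≤ k) (d : ℕ) :
    Nkd k d = ∑ a ∈ multiIndexBall k (nkd k d), ∑ j, a j + (nkd k d + 1) * mkd k d := by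
  simpa [Nkd] using (sum_multiIndexBall hk (nkd k d) id).symm

/-- Every set of `d + 1` multi-indices has total order at least `N_{k,d}`. -/
theorem Nkd_le_sum_of_card_eq {k d : ℕ} (hk : 1 ≤ k) {T : Finset (Fin k → ℕ)}
    (hT : T.card = d + 1) : Nkd k d ≤ ∑ a ∈ T, ∑ j, a j := by
  set c := nkd k d + 1 with hc
  set B := multiIndexBall k (nkd k d) with hB
  have hle : ∑ a ∈ T, (c - ∑ j, a j) ≤ ∑ a ∈ B, (c - ∑ j, a j) := by
    refine Finset.sum_le_sum_of_ne_zero fun a _ ha => ?_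
    rw [hB, mem_multiIndexBall]
    omega
  have hTsum : (d + 1) * c ≤ ∑ a ∈ T, ∑ j, a j + ∑ a ∈ T, (c - ∑ j, a j) := by
    rw [← Finset.sum_add_distrib, ← hT, ← smul_eq_mul]
    exact Finset.card_nsmul_le_sum _ _ _ fun a _ => le_add_tsub
  have hBsum : ∑ a ∈ B, ∑ j, a j + ∑ a ∈ B, (c - ∑ j, a j) = B.card * c := by
    rw [← Finset.sum_add_distrib, ← smul_eq_mul]
    refine Finset.sum_eq_card_nsmul fun a ha => ?_
    rw [hB, mem_multiIndexBall] at ha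
    omega
  have hN := Nkd_eq_sum_multiIndexBall hk d
  have hcard := card_multiIndexBall_add_mkd hk d
  rw [← hB, ← hc] at hN
  rw [← hcard, ← hB, add_mul, mul_comm (mkd k d)] at hTsum
  omega

/-- Some set of `d + 1` multi-indices has total order exactly `N_{k,d}`. -/
theorem exists_card_eq_sum_eq_Nkd {k : ℕ} (hk : 1 ≤ k) (d : ℕ) :
    ∃ T : Finset (Fin k → ℕ), T.card = d + 1 ∧ ∑ a ∈ T, ∑ j, a j = Nkd k d := by
  have hm := mkd_le_choose k d
  rw [← card_piAntidiag_fin hk] at hm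
  obtain ⟨M, hM, hMcard⟩ := Finset.exists_subset_card_eq hm
  have hMsum (a) (ha : a ∈ M) : ∑ j, a j = nkd k d + 1 := (Finset.mem_piAntidiag.1 (hM ha)).1
  have hdisj : Disjoint (multiIndexBall k (nkd k d)) M := by
    refine Finset.disjoint_left.2 fun a ha hb => ?_
    have h := hMsum a hb
    rw [mem_multiIndexBall] at ha
    omega
  refine ⟨(multiIndexBall k (nkd k d)).disjUnion M hdisj, ?_, ?_⟩
  · rw [Finset.card_disjUnion, hMcard, card_multiIndexBall_add_mkd hk]
  · rw [Finset.sum_disjUnion, Finset.sum_eq_card_nsmul hMsum, hMcard,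
      Nkd_eq_sum_multiIndexBall hk, smul_eq_mul, mul_comm (mkd k d)]

/-- **Combinatorial lemma.** If `α_1, …, α_{d+1} ∈ ℕ^k` are pairwise distinct
multi-indices then `|α_1| + ⋯ + |α_{d+1}| ≥ N_{k,d}`, and this bound is sharp. -/
theorem distinct_multiindices_sum_ge (k d : ℕ) (hk : 1 ≤ k) (hkd : k ≤ d) :
    (∀ α : Fin (d + 1) → (Fin k → ℕ), Function.Injective α →
      Nkd k d ≤ ∑ i, ∑ j, α i j) ∧
    (∃ α : Fin (d + 1) → (Fin k → ℕ), Function.Injective α ∧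
      (∑ i, ∑ j, α i j) = Nkd k d) := by
  refine ⟨fun α hα => ?_, ?_⟩
  · have h := Nkd_le_sum_of_card_eq hk (T := Finset.univ.map ⟨α, hα⟩) (d := d) (by simp)
    simpa using h
  · obtain ⟨T, hT, hsum⟩ := exists_card_eq_sum_eq_Nkd hk d
    let e := (T.equivFinOfCardEq hT).symm
    refine ⟨fun i => e i, Subtype.val_injective.comp e.injective, ?_⟩
    rw [← hsum, ← Finset.sum_coe_sort T]
    exact e.sum_comp fun a => ∑ j, (a : Fin k → ℕ) j
end
end
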